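/- Let μ, ν ∈ M₊(X) with μ(X) = ν(X). Assume that for each bounded upper semicontinuous ψ on X with −ψ = (−ψ)^G there exist functions ψ_n ∈ C²_c(ℝ^d) and Φ ∈ L¹(X) such that |ψ_n| ≤ |Φ| (μ+ν)-a.e. on X, −ψ_n = (−ψ_n)^G on Ω for every n, and ψ_n → ψ (μ+ν)-a.e. on X as n → ∞. Then F(μ,ν) = H(μ,ν). -/

import Mathlib

open MeasureTheory Set Filter Topology
open scoped ENNReal NNReal Classical

noncomputable section

/-- Euclidean space `ℝ^d`. -/
abbrev Ed (d : ℕ) := EuclideanSpace ℝ (Fin d)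

/-- The space `M_d` of real `d × d` matrices. -/
abbrev Matd (d : ℕ) := Matrix (Fin d) (Fin d) ℝ

/-- The Frobenius inner product `A : B = tr(Aᵀ B)`. -/
def frob {d : ℕ} (A B : Matd d) : ℝ := ∑ i, ∑ j, A i j * B i j

/-- The Frobenius norm of a matrix. -/
def matnorm {d : ℕ} (A : Matd d) : ℝ := Real.sqrt (frob A A)

/-- The Hessian matrix `∇²φ(x)`. -/
def hess {d : ℕ} (φ : Ed d → ℝ) (x : Ed d) : Matd d :=
  fun i j => iteratedFDeriv ℝ 2 φ x ![EuclideanSpace.single i 1, EuclideanSpace.single j 1]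

/-- `φ ∈ C²_c(ℝ^d)`. -/
def IsC2c {d : ℕ} (φ : Ed d → ℝ) : Prop := ContDiff ℝ 2 φ ∧ HasCompactSupport φ

/-- Assumption (A1): `dom f ⊆ S⁺_d`, `f` is coercive and sublinear
(subadditive and positively 1-homogeneous). -/
def CostA1 {d : ℕ} (f : Matd d → ℝ≥0∞) : Prop :=
  (∀ M, f M ≠ ⊤ → M.PosSemidef) ∧
  (∃ c : ℝ, 0 < c ∧ ∀ M, ENNReal.ofReal (c * matnorm M) ≤ f M) ∧
  (∀ A B, f (A + B) ≤ f A + f B) ∧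
  (∀ t : ℝ, 0 ≤ t → ∀ A, f (t • A) = ENNReal.ofReal t * f A)

/-- Assumption (A2): `f` is lower semicontinuous. -/
def CostA2 {d : ℕ} (f : Matd d → ℝ≥0∞) : Prop := LowerSemicontinuous f

/-- `dom(f⋆) = {A | A : M ≤ f(M) for all M ∈ dom f}`. -/
def domFstar {d : ℕ} (f : Matd d → ℝ≥0∞) : Set (Matd d) :=
  { A | ∀ M, f M ≠ ⊤ → ENNReal.ofReal (frob A M) ≤ f M }

/-- A competitor `λ = ρ·m` (an `S⁺_d`-valued measure supported in `X`) for the static problem: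
`tr(½∇²λ) = ν − μ` in the distributional sense. -/
def IsStaticCompetitor {d : ℕ} (X : Set (Ed d)) (μ ν : Measure (Ed d))
    (m : Measure (Ed d)) (ρ : Ed d → Matd d) : Prop :=
  IsFiniteMeasure m ∧ m Xᶜ = 0 ∧ (∀ x, (ρ x).PosSemidef) ∧
    ∀ φ : Ed d → ℝ, IsC2c φ →
      ∫ x, (1/2 : ℝ) * frob (hess φ x) (ρ x) ∂m = ∫ x, φ x ∂ν - ∫ x, φ x ∂μ

/-- The static value `F(μ,ν)` (using the positive 1-homogeneity of `f`, the cost of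
`λ = ρ·m` is `∫ f(dλ/d|λ|) d|λ| = ∫ f(ρ) dm`). -/
def Fstat {d : ℕ} (f : Matd d → ℝ≥0∞) (X : Set (Ed d)) (μ ν : Measure (Ed d)) : ℝ≥0∞ :=
  sInf { c | ∃ m ρ, IsStaticCompetitor X μ ν m ρ ∧ c = ∫⁻ x, f (ρ x) ∂m }

/-- `(ϱ, λ)`, with `ϱ = ϱ_t ⊗ L¹⌞(0,1)` and `λ = (ρ_t · m_t) ⊗ L¹⌞(0,1)` an `S⁺_d`-valued
measure, solves the Fokker–Planck equation `∂_t ϱ = tr(½∇²λ)` on `(0,1) × ℝ^d`. -/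
def SolvesFPE {d : ℕ} (ϱ : ℝ → Measure (Ed d)) (m : ℝ → Measure (Ed d))
    (ρ : ℝ → Ed d → Matd d) : Prop :=
  (∀ t ∈ Ioo (0:ℝ) 1, IsFiniteMeasure (ϱ t) ∧ IsFiniteMeasure (m t)) ∧
  (∀ t ∈ Ioo (0:ℝ) 1, ∀ x, (ρ t x).PosSemidef) ∧
  (∀ A : Set (Ed d), IsCompact A →
    (∫⁻ t in Ioo (0:ℝ) 1, ∫⁻ x in A, ENNReal.ofReal (matnorm (ρ t x)) ∂(m t)) < ⊤) ∧
  (∀ φ : ℝ × Ed d → ℝ, ContDiff ℝ 2 φ → HasCompactSupport φ →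
    tsupport φ ⊆ Ioo (0:ℝ) 1 ×ˢ (univ : Set (Ed d)) →
    (∫ t in Ioo (0:ℝ) 1, ∫ x, fderiv ℝ φ (t, x) (1, 0) ∂(ϱ t)) =
      - ∫ t in Ioo (0:ℝ) 1, ∫ x, (1/2 : ℝ) * frob (hess (fun y => φ (t, y)) x) (ρ t x) ∂(m t))

/-- The support condition (⋆): `supp ϱ_t, supp λ_t ⊆ X` for a.e. `t ∈ (0,1)`. -/
def SuppCond {d : ℕ} (X : Set (Ed d)) (ϱ m : ℝ → Measure (Ed d)) : Prop :=
  ∀ᵐ t ∂(volume.restrict (Ioo (0:ℝ) 1)), (ϱ t) Xᶜ = 0 ∧ (m t) Xᶜ = 0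

/-- `μ` is the weak* (narrow) limit of `ϱ_t` as `t → t₀` within `(0,1)`. -/
def NarrowLim {d : ℕ} (ϱ : ℝ → Measure (Ed d)) (t₀ : ℝ) (μ : Measure (Ed d)) : Prop :=
  ∀ g : BoundedContinuousFunction (Ed d) ℝ,
    Tendsto (fun t => ∫ x, g x ∂(ϱ t)) (𝓝[Ioo (0:ℝ) 1] t₀) (𝓝 (∫ x, g x ∂μ))

/-- The dynamic (Benamou–Brenier type) value `F(μ,ν)`. -/
def Fdyn {d : ℕ} (f : Matd d → ℝ≥0∞) (X : Set (Ed d)) (μ ν : Measure (Ed d)) : ℝ≥0∞ :=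
  sInf { c | ∃ ϱ m ρ, SolvesFPE ϱ m ρ ∧ SuppCond X ϱ m ∧
      NarrowLim ϱ 0 μ ∧ NarrowLim ϱ 1 ν ∧
      c = ∫⁻ t in Ioo (0:ℝ) 1, ∫⁻ x, f (ρ t x) ∂(m t) }

/-- the cost `G(x,p) := F(δ_x, p)`. -/
def Gcost {d : ℕ} (f : Matd d → ℝ≥0∞) (X : Set (Ed d)) (x : Ed d)
    (p : Measure (Ed d)) : ℝ≥0∞ :=
  Fstat f X (Measure.dirac x) p

/-- A disintegration kernel `x ↦ γ^x` of a transport plan `γ ∈ Π(μ,ν)`. -/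
def IsTransportKernel {d : ℕ} (X : Set (Ed d)) (μ ν : Measure (Ed d))
    (κ : Ed d → Measure (Ed d)) : Prop :=
  (∀ x, IsProbabilityMeasure (κ x) ∧ (κ x) Xᶜ = 0) ∧
  (∀ A : Set (Ed d), MeasurableSet A → Measurable fun x => κ x A) ∧
  (∀ A : Set (Ed d), MeasurableSet A → ∫⁻ x, κ x A ∂μ = ν A)

/-- The static optimal transport value `H(μ,ν) = inf_{γ ∈ Π(μ,ν)} ∫ G(x,γ^x) dμ`. -/
def Hcost {d : ℕ} (f : Matd d → ℝ≥0∞) (X : Set (Ed d)) (μ ν : Measure (Ed d)) : ℝ≥0∞ :=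
  sInf { c | ∃ κ, IsTransportKernel X μ ν κ ∧ c = ∫⁻ x, Gcost f X x (κ x) ∂μ }

/-- Integral of `φ` against a signed measure. -/
def sInt {d : ℕ} (s : SignedMeasure (Ed d)) (φ : Ed d → ℝ) : ℝ :=
  ∫ x, φ x ∂s.toJordanDecomposition.posPart - ∫ x, φ x ∂s.toJordanDecomposition.negPart

/-- A signed measure is supported in `X`. -/
def SuppInX {d : ℕ} (X : Set (Ed d)) (s : SignedMeasure (Ed d)) : Prop :=
  ∀ A : Set (Ed d), MeasurableSet A → A ⊆ Xᶜ → s A = 0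

/-- The extension of `F` to signed measures: `+∞` unless `μ, ν ≥ 0` with equal masses. -/
def FSgn {d : ℕ} (f : Matd d → ℝ≥0∞) (X : Set (Ed d)) (μ ν : SignedMeasure (Ed d)) : ℝ≥0∞ :=
  if 0 ≤ μ ∧ 0 ≤ ν ∧ μ univ = ν univ then
    Fstat f X μ.toJordanDecomposition.posPart ν.toJordanDecomposition.posPart
  else ⊤

/-- The extension of `H` to signed measures: `+∞` unless `μ, ν ≥ 0` with equal masses. -/
def HSgn {d : ℕ} (f : Matd d → ℝ≥0∞) (X : Set (Ed d)) (μ ν : SignedMeasure (Ed d)) : ℝ≥0∞ :=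
  if 0 ≤ μ ∧ 0 ≤ ν ∧ μ univ = ν univ then
    Hcost f X μ.toJordanDecomposition.posPart ν.toJordanDecomposition.posPart
  else ⊤

/-- The weak* topology on signed measures, in duality with continuous functions. -/
def weakStarTop (d : ℕ) : TopologicalSpace (SignedMeasure (Ed d)) :=
  ⨅ g : C(Ed d, ℝ), TopologicalSpace.induced (fun s => sInt s g) inferInstance

/-- The `G`-transform `φ^G(x) = inf { ∫ φ dp + G(x,p) : p ∈ P(X) }`. -/
def GTrans {d : ℕ} (f : Matd d → ℝ≥0∞) (X : Set (Ed d)) (φ : Ed d → ℝ) (x : Ed d) : EReal :=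
  sInf { c : EReal | ∃ p : Measure (Ed d), IsProbabilityMeasure p ∧ p Xᶜ = 0 ∧
      c = ((∫ y, φ y ∂p : ℝ) : EReal) + (Gcost f X x p : EReal) }

/-- `φ = φ^G` on `E`. -/
def GEq {d : ℕ} (f : Matd d → ℝ≥0∞) (X : Set (Ed d)) (φ : Ed d → ℝ) (E : Set (Ed d)) : Prop :=
  ∀ x ∈ E, GTrans f X φ x = ((φ x : ℝ) : EReal)

/-- `𝒯(A) = sup { A : M | M ∈ S⁺⁺_d, f(M) = 1 }`. -/
def Tcal {d : ℕ} (f : Matd d → ℝ≥0∞) (A : Matd d) : EReal :=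
  sSup { c : EReal | ∃ M : Matd d, M.PosDef ∧ f M = 1 ∧ c = ((frob A M : ℝ) : EReal) }

/-- `u` is a viscosity supersolution of `c − 𝒯(½∇²u) = 0` in `U`. -/
def IsViscSupersol {d : ℕ} (f : Matd d → ℝ≥0∞) (c : ℝ) (u : Ed d → ℝ) (U : Set (Ed d)) : Prop :=
  ∀ φ : Ed d → ℝ, ContDiffOn ℝ 2 φ U → ∀ x ∈ U,
    IsLocalMinOn (fun y => u y - φ y) U x →
    Tcal f ((1/2 : ℝ) • hess φ x) ≤ ((c : ℝ) : EReal)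

/-- Integral of an `EReal`-valued function against a measure
(positive part minus negative part). -/
def erealInt {d : ℕ} (m : Measure (Ed d)) (u : Ed d → EReal) : EReal :=
  ((∫⁻ y, ENNReal.ofReal ((u y).toReal) ∂m : ℝ≥0∞) : EReal) -
    ((∫⁻ y, (if u y = ⊥ then (⊤ : ℝ≥0∞) else ENNReal.ofReal (-(u y).toReal)) ∂m : ℝ≥0∞) : EReal)

/-- `u : U → ℝ ∪ {−∞}` is subharmonic on the open set `U`: it is upper semicontinuous,
not identically `−∞` on any connected component, and satisfies the sub-mean value
inequality on spheres. -/
def Subharmonic {d : ℕ} (U : Set (Ed d)) (u : Ed d → EReal) : Prop :=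
  (∀ x, u x ≠ ⊤) ∧
  (∀ x ∈ U, ∃ y ∈ connectedComponentIn U x, u y ≠ ⊥) ∧
  UpperSemicontinuousOn u U ∧
  (∀ x ∈ U, ∀ r : ℝ, 0 < r → Metric.closedBall x r ⊆ U →
    (((μH[(d : ℝ) - 1] (Metric.sphere x r)).toReal : ℝ) : EReal) * u x ≤
      erealInt ((μH[(d : ℝ) - 1]).restrict (Metric.sphere x r)) u)

/-- The (topological) support of a measure. -/
def msupp {d : ℕ} (m : Measure (Ed d)) : Set (Ed d) :=
  { x | ∀ U : Set (Ed d), IsOpen U → x ∈ U → m U ≠ 0 }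

/-- `m₁ ≤_SH m₂`: subharmonic order. -/
def SHOrder {d : ℕ} (m₁ m₂ : Measure (Ed d)) : Prop :=
  ∀ U : Set (Ed d), IsOpen U → msupp (m₁ + m₂) ⊆ U →
    ∀ u : Ed d → EReal, Subharmonic U u →
      erealInt (m₁.restrict U) u ≤ erealInt (m₂.restrict U) u

/-- The second moment matrix `∫ x ⊗ x dκ`. -/
def secondMoment {d : ℕ} (κ : Measure (Ed d)) : Matd d :=
  fun i j => ∫ x, x i * x j ∂κ

end

/-- Abstract Hahn–Banach lemma: a convex cone of constraints `L h ≤ r` is solvable. -/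
lemma hb_aux {E : Type*} [AddCommGroup E] [Module ℝ E] (K : E → ℝ → Prop)
    (hadd : ∀ h r h' r', K h r → K h' r' → K (h + h') (r + r'))
    (hsmul : ∀ c : ℝ, 0 < c → ∀ h r, K h r → K (c • h) (c * r))
    (hdom : ∀ h, ∃ r, K h r) (hpos : ∀ r, K 0 r → 0 ≤ r) :
    ∃ L : E →ₗ[ℝ] ℝ, ∀ h r, K h r → L h ≤ r := by
  set N : E → ℝ := fun h => sInf {r | K h r} with hN
  have hbdd : ∀ h, BddBelow {r | K h r} := by
    intro h
    obtain ⟨r0, hr0⟩ := hdom (-h)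
    refine ⟨-r0, fun r hr => ?_⟩
    have := hpos (r + r0) (by simpa using hadd _ _ _ _ hr hr0)
    linarith
  have hle : ∀ c : ℝ, 0 < c → ∀ x, N (c • x) ≤ c * N x := by
    intro c hc x
    rw [← div_le_iff₀' hc]
    refine le_csInf (hdom x) fun r hr => ?_
    rw [div_le_iff₀' hc]
    exact csInf_le (hbdd _) (hsmul c hc _ _ hr)
  obtain ⟨g, -, hg⟩ := exists_extension_of_le_sublinear (⊥ : E →ₗ.[ℝ] ℝ) N
    (by
      intro c hc x
      refine le_antisymm (hle c hc x) ?_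
      have := hle c⁻¹ (inv_pos.2 hc) (c • x)
      rw [smul_smul, inv_mul_cancel₀ hc.ne', one_smul] at this
      rw [← div_eq_inv_mul, le_div_iff₀' hc] at this
      exact this)
    (by
      intro x y
      rw [← sub_le_iff_le_add]
      refine le_csInf (hdom x) fun r hr => ?_
      rw [sub_le_comm]
      refine le_csInf (hdom y) fun r' hr' => ?_
      rw [sub_le_iff_le_add']
      exact csInf_le (hbdd _) (hadd _ _ _ _ hr hr'))
    (by
      rintro ⟨x, hx⟩
      have hx' : x ∈ (⊥ : Submodule ℝ E) := hx
      have hx0 : x = 0 := by simpa using hx'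
      subst hx0
      have h0 : (⊥ : E →ₗ.[ℝ] ℝ) ⟨0, hx⟩ = 0 := rfl
      rw [h0]
      exact le_csInf (hdom 0) fun r hr => hpos r hr)
  exact ⟨g, fun h r hr => (hg h).trans (csInf_le (hbdd h) hr)⟩

/-- Riesz–Markov on a compact space, for a positive linear functional. -/
lemma riesz_aux {Y : Type*} [TopologicalSpace Y] [T2Space Y] [CompactSpace Y] [MeasurableSpace Y]
    [BorelSpace Y] (L : C(Y, ℝ) →ₗ[ℝ] ℝ) (hL : ∀ g : C(Y, ℝ), 0 ≤ g → 0 ≤ L g) :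
    ∃ m : Measure Y, IsFiniteMeasure m ∧ ∀ g : C(Y, ℝ), ∫ y, g y ∂m = L g := by
  let Λ : CompactlySupportedContinuousMap Y ℝ →ₚ[ℝ] ℝ := PositiveLinearMap.mk₀
    { toFun := fun g => L g.toContinuousMap
      map_add' := fun f g => L.map_add f.toContinuousMap g.toContinuousMap
      map_smul' := fun c f => L.map_smul c f.toContinuousMap }
    (fun g hg => hL _ hg)
  refine ⟨RealRMK.rieszMeasure Λ, inferInstance, fun g => ?_⟩
  exact RealRMK.integral_rieszMeasure Λ
    (CompactlySupportedContinuousMap.continuousMapEquiv g)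

lemma part_choice {Y : Type*} [MeasurableSpace Y] (g : ℕ → Y → ℝ)
    (hg : ∀ k, Measurable (g k)) (n : ℕ) :
    ∃ w : ℕ → Y → ℝ, (∀ k, Measurable (w k)) ∧ (∀ k y, 0 ≤ w k y) ∧
      (∀ y, ∑ k ∈ Finset.range n, w k y ≤ 1) ∧
      ∀ y, (0 ≤ ∑ k ∈ Finset.range n, w k y * g k y) ∧
        ∀ k < n, g k y ≤ ∑ k ∈ Finset.range n, w k y * g k y := by
  induction n with
  | zero => exact ⟨fun _ _ => 0, fun _ => measurable_const, fun _ _ => le_rfl, by simp, by simp⟩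
  | succ n ih =>
    obtain ⟨w, hw, hw0, hw1, hws⟩ := ih
    set S : Y → ℝ := fun y => ∑ k ∈ Finset.range n, w k y * g k y with hS
    have hSm : Measurable S := by
      apply Finset.measurable_fun_sum
      intro k _
      exact (hw k).mul (hg k)
    set B : Set Y := {y | S y < g n y}
    have hB : MeasurableSet B := measurableSet_lt hSm (hg n)
    refine ⟨fun k => if k = n then B.indicator 1 else Bᶜ.indicator (w k), ?_, ?_, ?_, ?_⟩
    · intro k
      beta_reduce
      split_ifs
      · exact measurable_one.indicator hB
      · exact (hw k).indicator hB.compl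
    · intro k y
      beta_reduce
      split_ifs
      · exact indicator_nonneg (fun _ _ => zero_le_one) y
      · exact indicator_nonneg (fun _ _ => hw0 k _) y
    · intro y
      rw [Finset.sum_range_succ]
      have : ∑ k ∈ Finset.range n, (if k = n then B.indicator 1 else Bᶜ.indicator (w k)) y
          = ∑ k ∈ Finset.range n, Bᶜ.indicator (w k) y := by
        refine Finset.sum_congr rfl fun k hk => ?_
        rw [if_neg (Finset.mem_range.1 hk).ne]
      rw [this]
      by_cases hy : y ∈ B
      · simp [hy]
      · simpa [hy] using hw1 y
    · intro y
      rw [Finset.sum_range_succ]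
      have : ∑ k ∈ Finset.range n, (if k = n then B.indicator 1 else Bᶜ.indicator (w k)) y * g k y
          = ∑ k ∈ Finset.range n, Bᶜ.indicator (w k) y * g k y := by
        refine Finset.sum_congr rfl fun k hk => ?_
        rw [if_neg (Finset.mem_range.1 hk).ne]
      rw [this]
      obtain ⟨h0, h1⟩ := hws y
      by_cases hy : y ∈ B
      · have hy' : S y < g n y := hy
        simp only [mem_compl_iff, hy, not_true_eq_false, not_false_eq_true,
          indicator_of_notMem, zero_mul, Finset.sum_const_zero, if_true, indicator_of_mem,
          Pi.one_apply, one_mul, zero_add]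
        refine ⟨h0.trans hy'.le, fun k hk => ?_⟩
        rcases Nat.lt_succ_iff_lt_or_eq.1 hk with h | h
        · exact (h1 k h).trans hy'.le
        · rw [h]
      · have hy' : g n y ≤ S y := not_lt.1 hy
        simp only [mem_compl_iff, hy, not_false_eq_true, indicator_of_mem, if_true,
          indicator_of_notMem, zero_mul, add_zero]
        refine ⟨h0, fun k hk => ?_⟩
        rcases Nat.lt_succ_iff_lt_or_eq.1 hk with h | h
        · exact h1 k h
        · rw [h]; exact hy'

/-- Approximation of measurable subpartitions of unity by continuous ones. -/
lemma part_approx {Y : Type*} [MetricSpace Y] [CompactSpace Y] [MeasurableSpace Y] [BorelSpace Y]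
    (m : Measure Y) [IsFiniteMeasure m] (g : ℕ → Y → ℝ)
    (hgi : ∀ k, Integrable (g k) m) (D : ℝ) (n : ℕ)
    (h : ∀ w : ℕ → C(Y, ℝ), (∀ k y, 0 ≤ w k y) →
      (∀ y, ∑ k ∈ Finset.range n, w k y ≤ 1) →
      ∑ k ∈ Finset.range n, ∫ y, w k y * g k y ∂m ≤ D)
    (w : ℕ → Y → ℝ) (hw : ∀ k, Measurable (w k)) (hw0 : ∀ k y, 0 ≤ w k y)
    (hw1 : ∀ y, ∑ k ∈ Finset.range n, w k y ≤ 1) :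
    ∑ k ∈ Finset.range n, ∫ y, w k y * g k y ∂m ≤ D := by
  set W : Y → (Fin n → ℝ) := fun y k => w k y with hW
  have hWm : Measurable W := measurable_pi_lambda _ fun k => hw k
  have hle1 : ∀ k < n, ∀ y, w k y ≤ 1 := fun k hk y =>
    (Finset.single_le_sum (f := fun k => w k y) (fun k _ => hw0 k y)
      (Finset.mem_range.2 hk)).trans (hw1 y)
  have hWL : MemLp W 1 m := by
    refine MemLp.of_bound hWm.aestronglyMeasurable 1 (Eventually.of_forall fun y => ?_)
    rw [pi_norm_le_iff_of_nonneg zero_le_one]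
    intro k
    rw [Real.norm_eq_abs, abs_of_nonneg (hw0 _ _)]
    exact hle1 k k.2 y
  have hex : ∀ j : ℕ, ∃ v : BoundedContinuousFunction Y (Fin n → ℝ),
      eLpNorm (W - (v : Y → (Fin n → ℝ))) 1 m ≤ ((j : ℝ≥0∞) + 1)⁻¹ ∧ MemLp v 1 m := fun j =>
    hWL.exists_boundedContinuous_eLpNorm_sub_le ENNReal.one_ne_top (by simp)
  choose v hv hvL using hex
  have hten : Tendsto (fun j => eLpNorm ((v j : Y → (Fin n → ℝ)) - W) 1 m) atTop (𝓝 0) := by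
    refine tendsto_of_tendsto_of_tendsto_of_le_of_le tendsto_const_nhds
      (h := fun j : ℕ => ((j : ℝ≥0∞) + 1)⁻¹) ?_ (fun _ => zero_le) (fun j => ?_)
    · have := ENNReal.tendsto_inv_nat_nhds_zero.comp (tendsto_add_atTop_nat 1)
      refine this.congr fun j => ?_
      simp
    · rw [eLpNorm_sub_comm]; exact hv j
  obtain ⟨ns, -, hns⟩ := (tendstoInMeasure_of_tendsto_eLpNorm one_ne_zero
    (fun j => (hvL j).1) hWL.1 hten).exists_seq_tendsto_ae
  set a : ℕ → ℕ → Y → ℝ := fun j k y =>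
    if hk : k < n then max (v (ns j) y ⟨k, hk⟩) 0 else 0 with ha
  have hac : ∀ j k, Continuous (a j k) := by
    intro j k
    by_cases hk : k < n
    · simp only [ha, hk, dite_true]
      exact (((continuous_apply _).comp (v (ns j)).continuous)).max continuous_const
    · simp only [ha, hk, dite_false]; exact continuous_const
  have ha0 : ∀ j k y, 0 ≤ a j k y := by
    intro j k y
    simp only [ha]; split_ifs
    · exact le_max_right _ _
    · exact le_rfl
  set s : ℕ → Y → ℝ := fun j y => max 1 (∑ k ∈ Finset.range n, a j k y) with hs
  have hsc : ∀ j, Continuous (s j) := fun j =>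
    continuous_const.max (continuous_finsetSum _ fun k _ => hac j k)
  have hs1 : ∀ j y, 1 ≤ s j y := fun j y => le_max_left _ _
  have hs0 : ∀ j y, 0 < s j y := fun j y => zero_lt_one.trans_le (hs1 j y)
  set b : ℕ → ℕ → C(Y, ℝ) := fun j k =>
    ⟨fun y => a j k y / s j y, (hac j k).div (hsc j) fun y => (hs0 j y).ne'⟩ with hb
  have hbs : ∀ j y, ∑ k ∈ Finset.range n, b j k y ≤ 1 := by
    intro j y
    simp only [hb, ContinuousMap.coe_mk]
    rw [← Finset.sum_div, div_le_one (hs0 j y)]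
    exact le_max_right _ _
  have hb0 : ∀ j k y, 0 ≤ b j k y := fun j k y => div_nonneg (ha0 j k y) (hs0 j y).le
  have hb1 : ∀ j, ∀ k < n, ∀ y, b j k y ≤ 1 := fun j k hk y =>
    (Finset.single_le_sum (f := fun k => b j k y) (fun k _ => hb0 j k y)
      (Finset.mem_range.2 hk)).trans (hbs j y)
  have hlim : ∀ᵐ y ∂m, ∀ k < n, Tendsto (fun j => b j k y) atTop (𝓝 (w k y)) := by
    filter_upwards [hns] with y hy k hk
    rw [tendsto_pi_nhds] at hy
    have h1 : ∀ k < n, Tendsto (fun j => a j k y) atTop (𝓝 (w k y)) := by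
      intro k hk
      have := (hy ⟨k, hk⟩).max (tendsto_const_nhds (x := (0 : ℝ)))
      simp only [ha, hk, dite_true]
      simpa [hW, max_eq_left (hw0 k y)] using this
    have h2 : Tendsto (fun j => s j y) atTop (𝓝 (max 1 (∑ k ∈ Finset.range n, w k y))) :=
      tendsto_const_nhds.max (tendsto_finsetSum _ fun k hk => h1 k (Finset.mem_range.1 hk))
    rw [max_eq_left (hw1 y)] at h2
    have h3 := (h1 k hk).div h2 one_ne_zero
    rw [div_one] at h3
    exact h3
  have hT : Tendsto (fun j => ∑ k ∈ Finset.range n, ∫ y, b j k y * g k y ∂m) atTop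
      (𝓝 (∑ k ∈ Finset.range n, ∫ y, w k y * g k y ∂m)) := by
    refine tendsto_finsetSum _ fun k hk => ?_
    have hk := Finset.mem_range.1 hk
    refine tendsto_integral_of_dominated_convergence (fun y => ‖g k y‖)
      (fun j => (b j k).continuous.aestronglyMeasurable.mul (hgi k).1) (hgi k).norm
      (fun j => Eventually.of_forall fun y => ?_) ?_
    · rw [norm_mul, Real.norm_eq_abs, abs_of_nonneg (hb0 j k y)]
      exact mul_le_of_le_one_left (norm_nonneg _) (hb1 j k hk y)
    · filter_upwards [hlim] with y hy
      exact (hy k hk).mul_const _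
  exact le_of_tendsto' hT fun j => h (b j) (hb0 j) (hbs j)

lemma part_aux {Y : Type*} [MetricSpace Y] [CompactSpace Y] [MeasurableSpace Y] [BorelSpace Y]
    (m : Measure Y) [IsFiniteMeasure m] (g : ℕ → Y → ℝ) (hg : ∀ k, Measurable (g k))
    (hgi : ∀ k, Integrable (g k) m) (D : ℝ)
    (h : ∀ n : ℕ, ∀ w : ℕ → C(Y, ℝ), (∀ k y, 0 ≤ w k y) →
      (∀ y, ∑ k ∈ Finset.range n, w k y ≤ 1) →
      ∑ k ∈ Finset.range n, ∫ y, w k y * g k y ∂m ≤ D) :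
    ∫⁻ y, ⨆ k, ENNReal.ofReal (g k y) ∂m ≤ ENNReal.ofReal D := by
  have key : ∀ y, ⨆ k, ENNReal.ofReal (g k y) =
      ⨆ n, ⨆ k ∈ Finset.range n, ENNReal.ofReal (g k y) := by
    intro y
    refine le_antisymm (iSup_le fun k => ?_) (iSup_le fun n => iSup₂_le fun k _ => ?_)
    · exact le_iSup_of_le (k + 1) (le_iSup₂_of_le k (by simp) le_rfl)
    · exact le_iSup (fun k => ENNReal.ofReal (g k y)) k
  simp_rw [key]
  rw [lintegral_iSup]
  · refine iSup_le fun n => ?_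
    obtain ⟨w, hw, hw0, hw1, hws⟩ := part_choice g hg n
    have hle1 : ∀ k < n, ∀ y, w k y ≤ 1 := fun k hk y =>
      (Finset.single_le_sum (f := fun k => w k y) (fun k _ => hw0 k y)
        (Finset.mem_range.2 hk)).trans (hw1 y)
    have hintg : ∀ k ∈ Finset.range n, Integrable (fun y => w k y * g k y) m := by
      intro k hk
      refine (hgi k).mono ((hw k).mul (hg k)).aestronglyMeasurable
        (Eventually.of_forall fun y => ?_)
      rw [norm_mul, Real.norm_eq_abs, abs_of_nonneg (hw0 k y)]
      exact mul_le_of_le_one_left (norm_nonneg _) (hle1 k (Finset.mem_range.1 hk) y)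
    calc ∫⁻ y, ⨆ k ∈ Finset.range n, ENNReal.ofReal (g k y) ∂m
        ≤ ∫⁻ y, ENNReal.ofReal (∑ k ∈ Finset.range n, w k y * g k y) ∂m := by
          refine lintegral_mono fun y => iSup₂_le fun k hk => ?_
          exact ENNReal.ofReal_le_ofReal ((hws y).2 k (Finset.mem_range.1 hk))
      _ = ENNReal.ofReal (∫ y, ∑ k ∈ Finset.range n, w k y * g k y ∂m) := by
          rw [ofReal_integral_eq_lintegral_ofReal (integrable_finsetSum _ hintg)
            (Eventually.of_forall fun y => (hws y).1)]
      _ ≤ ENNReal.ofReal D := by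
          apply ENNReal.ofReal_le_ofReal
          rw [integral_finsetSum _ hintg]
          exact part_approx m g hgi D n (h n) w hw hw0 hw1
  · intro n
    exact Measurable.iSup fun k => Measurable.iSup fun _ => (hg k).ennreal_ofReal
  · intro n n' hn y
    exact biSup_mono fun k hk => Finset.range_mono hn hk

/-- Reduction of a supremum over a subset of a separable metric space to a sequence. -/
lemma exists_seq_sup {T : Type*} [TopologicalSpace T] [SecondCountableTopology T]
    (A : Set T) (hA : A.Nonempty) :
    ∃ a : ℕ → T, (∀ k, a k ∈ A) ∧ ∀ g : T → ℝ, Continuous g → ∀ t ∈ A,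
      ENNReal.ofReal (g t) ≤ ⨆ k, ENNReal.ofReal (g (a k)) := by
  have : Nonempty A := hA.to_subtype
  refine ⟨fun k => (TopologicalSpace.denseSeq A k : T), fun k => (TopologicalSpace.denseSeq A k).2,
    fun g hg t ht => ?_⟩
  have hc : Continuous fun s : A => ENNReal.ofReal (g s) :=
    ENNReal.continuous_ofReal.comp (hg.comp continuous_subtype_val)
  have hcl : IsClosed {s : A | ENNReal.ofReal (g s) ≤
      ⨆ k, ENNReal.ofReal (g (TopologicalSpace.denseSeq A k))} :=
    isClosed_le hc continuous_const
  have := (TopologicalSpace.denseRange_denseSeq A).induction_on (p := fun s : A =>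
    ENNReal.ofReal (g s) ≤ ⨆ k, ENNReal.ofReal (g (TopologicalSpace.denseSeq A k)))
    ⟨t, ht⟩ hcl (fun k => le_iSup (fun k => ENNReal.ofReal (g (TopologicalSpace.denseSeq A k))) k)
  exact this

/-! ### Matrices -/

section Matrices

variable {d : ℕ}

lemma frob_add_left (A B M : Matd d) : frob (A + B) M = frob A M + frob B M := by
  simp [frob, add_mul, Finset.sum_add_distrib]

lemma frob_smul_left (c : ℝ) (A M : Matd d) : frob (c • A) M = c * frob A M := by
  simp [frob, Finset.mul_sum, mul_assoc]

lemma frob_zero_left (M : Matd d) : frob 0 M = 0 := by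
  simp [frob]

lemma frob_neg_left (A M : Matd d) : frob (-A) M = - frob A M := by
  simp [frob]

lemma frob_sum_left {ι : Type*} (s : Finset ι) (A : ι → Matd d) (M : Matd d) :
    frob (∑ k ∈ s, A k) M = ∑ k ∈ s, frob (A k) M := by
  induction s using Finset.cons_induction with
  | empty => simp [frob_zero_left]
  | cons a s ha ih => rw [Finset.sum_cons, Finset.sum_cons, frob_add_left, ih]

lemma continuous_frob_left (M : Matd d) : Continuous fun A : Matd d => frob A M := by
  unfold frob
  fun_prop

lemma frob_le_matnorm (A M : Matd d) : frob A M ≤ matnorm A * matnorm M := by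
  have h0 : 0 ≤ frob A A :=
    Finset.sum_nonneg fun i _ => Finset.sum_nonneg fun j _ => mul_self_nonneg (A i j)
  unfold matnorm
  rw [← Real.sqrt_mul h0]
  apply Real.le_sqrt_of_sq_le
  unfold frob
  simp only [← Finset.sum_product']
  have := Finset.sum_mul_sq_le_sq_mul_sq (Finset.univ ×ˢ Finset.univ : Finset (Fin d × Fin d))
    (fun p => A p.1 p.2) (fun p => M p.1 p.2)
  simpa [sq] using this

lemma matnorm_nonneg (A : Matd d) : 0 ≤ matnorm A := Real.sqrt_nonneg _

lemma continuous_matnorm : Continuous (matnorm : Matd d → ℝ) := by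
  unfold matnorm frob
  fun_prop

lemma matnorm_smul (c : ℝ) (A : Matd d) : matnorm (c • A) = |c| * matnorm A := by
  unfold matnorm
  have : frob (c • A) (c • A) = c ^ 2 * frob A A := by
    simp only [frob, Matrix.smul_apply, smul_eq_mul, Finset.mul_sum]
    refine Finset.sum_congr rfl fun i _ => Finset.sum_congr rfl fun j _ => by ring
  rw [this, Real.sqrt_mul (sq_nonneg c), Real.sqrt_sq_eq_abs]

/-- `B ∈ dom f⋆`. -/
def InDom (f : Matd d → ℝ≥0∞) (B : Matd d) : Prop :=
  ∀ M, ENNReal.ofReal (frob B M) ≤ f M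

lemma InDom.zero (f : Matd d → ℝ≥0∞) : InDom f 0 := by
  intro M; simp [frob_zero_left]

lemma InDom.sum {f : Matd d → ℝ≥0∞} {ι : Type*} (s : Finset ι) (w : ι → ℝ) (B : ι → Matd d)
    (hw : ∀ k ∈ s, 0 ≤ w k) (hs : ∑ k ∈ s, w k ≤ 1) (hB : ∀ k ∈ s, InDom f (B k)) :
    InDom f (∑ k ∈ s, w k • B k) := by
  intro M
  rw [frob_sum_left]
  simp_rw [frob_smul_left]
  by_cases hM : f M = ⊤
  · rw [hM]; exact le_top
  have h1 : ∀ k ∈ s, frob (B k) M ≤ (f M).toReal := fun k hk =>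
    (ENNReal.ofReal_le_iff_le_toReal hM).1 (hB k hk M)
  rw [ENNReal.ofReal_le_iff_le_toReal hM]
  calc ∑ k ∈ s, w k * frob (B k) M ≤ ∑ k ∈ s, w k * (f M).toReal :=
        Finset.sum_le_sum fun k hk => mul_le_mul_of_nonneg_left (h1 k hk) (hw k hk)
    _ = (∑ k ∈ s, w k) * (f M).toReal := by rw [Finset.sum_mul]
    _ ≤ _ := mul_le_of_le_one_left ENNReal.toReal_nonneg hs

lemma InDom.comb {f : Matd d → ℝ≥0∞} {a b : ℝ} {A B : Matd d} (ha : 0 ≤ a) (hb : 0 ≤ b)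
    (hab : a + b ≤ 1) (hA : InDom f A) (hB : InDom f B) : InDom f (a • A + b • B) := by
  have := InDom.sum (f := f) (Finset.univ : Finset (Fin 2)) ![a, b] ![A, B]
    (by simp [Fin.forall_fin_two, ha, hb]) (by simpa using hab)
    (by simp [Fin.forall_fin_two, hA, hB])
  simpa using this

lemma InDom.closed (f : Matd d → ℝ≥0∞) : IsClosed {B | InDom f B} := by
  simp only [InDom, ofPred_forall]
  refine isClosed_iInter fun M => isClosed_le ?_ continuous_const
  exact ENNReal.continuous_ofReal.comp (continuous_frob_left M)

lemma cost_zero {f : Matd d → ℝ≥0∞} (hA1 : CostA1 f) : f 0 = 0 := by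
  have := hA1.2.2.2 0 le_rfl 0
  simpa using this

lemma linear_eq_frob (ℓ : Matd d →ₗ[ℝ] ℝ) :
    ∃ B : Matd d, ∀ M, ℓ M = frob B M := by
  refine ⟨fun i j => ℓ (Matrix.single i j 1), fun M => ?_⟩
  conv_lhs => rw [Matrix.matrix_eq_sum_single M]
  simp only [map_sum, frob]
  refine Finset.sum_congr rfl fun i _ => Finset.sum_congr rfl fun j _ => ?_
  have : Matrix.single i j (M i j) = (M i j) • Matrix.single i j (1 : ℝ) := by
    simp [Matrix.smul_single]
  rw [this, map_smul, smul_eq_mul, mul_comm]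

/-- Bipolar theorem for the sublinear lower semicontinuous cost. -/
lemma bipolar {f : Matd d → ℝ≥0∞} (hA1 : CostA1 f) (hA2 : CostA2 f) (M : Matd d) (s : ℝ)
    (hs0 : 0 ≤ s) (hs : ENNReal.ofReal s < f M) : ∃ B, InDom f B ∧ s < frob B M := by
  obtain ⟨-, -, hsub, hhom⟩ := hA1
  have hf0 : f 0 = 0 := by simpa using hhom 0 le_rfl 0
  set T : Set (Matd d × ℝ) := {p | 0 ≤ p.2 ∧ f p.1 ≤ ENNReal.ofReal p.2} with hT
  have hTcl : IsClosed T := by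
    refine IsClosed.inter (isClosed_le continuous_const continuous_snd) ?_
    have h1 := hA2.isClosed_epigraph
    have h2 : Continuous fun p : Matd d × ℝ => (p.1, ENNReal.ofReal p.2) :=
      continuous_fst.prodMk (ENNReal.continuous_ofReal.comp continuous_snd)
    exact h1.preimage h2
  have hTsm : ∀ c : ℝ, 0 ≤ c → ∀ p ∈ T, c • p ∈ T := by
    rintro c hc ⟨A, t⟩ ⟨h1, h2⟩
    refine ⟨mul_nonneg hc h1, ?_⟩
    simp only [Prod.smul_mk, smul_eq_mul] at *
    rw [hhom c hc, ENNReal.ofReal_mul hc]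
    gcongr
  have hTadd : ∀ p ∈ T, ∀ q ∈ T, p + q ∈ T := by
    rintro ⟨A, t⟩ ⟨h1, h2⟩ ⟨B, u⟩ ⟨h3, h4⟩
    refine ⟨add_nonneg h1 h3, ?_⟩
    simp only [Prod.mk_add_mk] at *
    rw [ENNReal.ofReal_add h1 h3]
    exact (hsub A B).trans (add_le_add h2 h4)
  have hTcv : Convex ℝ T := by
    intro p hp q hq a b ha hb _
    exact hTadd _ (hTsm a ha p hp) _ (hTsm b hb q hq)
  have hnot : (M, s) ∉ T := fun h => not_le.2 hs h.2
  have hlc : LocallyConvexSpace ℝ (Matd d) :=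
    inferInstanceAs (LocallyConvexSpace ℝ (Fin d → Fin d → ℝ))
  obtain ⟨ℓ, u, hu1, hu2⟩ := geometric_hahn_banach_point_closed hTcv hTcl hnot
  have h0T : (0 : Matd d × ℝ) ∈ T := by simp [hT, hf0]
  have hu0 : u < 0 := by simpa using hu2 0 h0T
  have hnn : ∀ p ∈ T, 0 ≤ ℓ p := by
    intro p hp
    by_contra hneg
    push Not at hneg
    have := hu2 _ (hTsm (u / ℓ p) (div_nonneg_of_nonpos hu0.le hneg.le) p hp)
    rw [map_smul, smul_eq_mul, div_mul_cancel₀ _ hneg.ne] at this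
    exact lt_irrefl _ this
  obtain ⟨B, hB⟩ := linear_eq_frob ((ℓ : Matd d × ℝ →ₗ[ℝ] ℝ).comp (LinearMap.inl ℝ (Matd d) ℝ))
  have hB' : ∀ A, ℓ (A, 0) = frob B A := fun A => by simpa using hB A
  set τ : ℝ := ℓ (0, 1) with hτ
  have hdec : ∀ A t, ℓ (A, t) = frob B A + t * τ := by
    intro A t
    have : (A, t) = (A, (0 : ℝ)) + t • ((0 : Matd d), (1 : ℝ)) := by simp
    rw [this, map_add, map_smul, hB', smul_eq_mul]
  have hτ0 : 0 ≤ τ := hnn _ (by simp [hT, hf0])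
  have hMs : frob B M + s * τ < 0 := by rw [← hdec]; exact hu1.trans hu0
  have hdom : ∀ A, f A ≠ ⊤ → 0 ≤ frob B A + (f A).toReal * τ := by
    intro A hA
    rw [← hdec]
    exact hnn _ ⟨ENNReal.toReal_nonneg, by simp [ENNReal.ofReal_toReal hA]⟩
  rcases hτ0.eq_or_lt with h | h
  · rw [← h] at hMs hdom
    simp only [mul_zero, add_zero] at hMs hdom
    set c : ℝ := (s + 1) / (-frob B M) with hc
    have hc0 : 0 < c := div_pos (by linarith) (by linarith)
    refine ⟨(-c) • B, fun A => ?_, ?_⟩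
    · by_cases hA : f A = ⊤
      · rw [hA]; exact le_top
      · rw [frob_smul_left, ENNReal.ofReal_of_nonpos]
        · exact zero_le
        · nlinarith [hdom A hA]
    · rw [frob_smul_left, hc]
      have : -((s + 1) / (-frob B M)) * frob B M = s + 1 := by
        have : frob B M ≠ 0 := hMs.ne
        field_simp
      rw [this]; linarith
  · refine ⟨(-τ⁻¹) • B, fun A => ?_, ?_⟩
    · by_cases hA : f A = ⊤
      · rw [hA]; exact le_top
      · rw [frob_smul_left, ENNReal.ofReal_le_iff_le_toReal hA]
        have := hdom A hA
        rw [neg_mul, ← div_eq_inv_mul, ← neg_div, div_le_iff₀ h]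
        linarith
    · rw [frob_smul_left, neg_mul, ← div_eq_inv_mul, ← neg_div, lt_div_iff₀ h]
      linarith

lemma bipolar_seq {f : Matd d → ℝ≥0∞} (hA1 : CostA1 f) (hA2 : CostA2 f) :
    ∃ B : ℕ → Matd d, (∀ k, InDom f (B k)) ∧
      ∀ M, f M = ⨆ k, ENNReal.ofReal (frob (B k) M) := by
  have hsc : SecondCountableTopology (Matd d) :=
    inferInstanceAs (SecondCountableTopology (Fin d → Fin d → ℝ))
  obtain ⟨B, hB, hBs⟩ := exists_seq_sup {B : Matd d | InDom f B} ⟨0, InDom.zero f⟩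
  refine ⟨B, hB, fun M => le_antisymm ?_ (iSup_le fun k => hB k M)⟩
  refine le_of_forall_lt fun r hr => ?_
  obtain ⟨r', hr1, hr2⟩ := exists_between hr
  have hr't : r' ≠ ⊤ := (hr2.trans_le le_top).ne
  obtain ⟨C, hC, hC2⟩ := bipolar hA1 hA2 M r'.toReal ENNReal.toReal_nonneg
    (by rwa [ENNReal.ofReal_toReal hr't])
  refine hr1.trans_le (le_trans ?_ (hBs (fun B => frob B M) (continuous_frob_left M) C hC))
  rw [← ENNReal.ofReal_toReal hr't]
  exact ENNReal.ofReal_le_ofReal hC2.le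

lemma inDom_of_matnorm {f : Matd d → ℝ≥0∞} {c : ℝ}
    (hc : ∀ M, ENNReal.ofReal (c * matnorm M) ≤ f M) {B : Matd d} (hB : matnorm B ≤ c) :
    InDom f B := fun M =>
  (ENNReal.ofReal_le_ofReal ((frob_le_matnorm B M).trans
    (mul_le_mul_of_nonneg_right hB (matnorm_nonneg M)))).trans (hc M)

lemma inDom_of_neg {f : Matd d → ℝ≥0∞} (hA1 : CostA1 f) {B : Matd d}
    (hB : ∀ M : Matd d, M.PosSemidef → frob B M ≤ 0) : InDom f B := by
  intro M
  by_cases hM : f M = ⊤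
  · rw [hM]; exact le_top
  · rw [ENNReal.ofReal_of_nonpos (hB M (hA1.1 M hM))]; exact zero_le

/-- `E_ij + I` pairs nonnegatively with positive semidefinite matrices. -/
lemma frob_single_add_one {M : Matd d} (hM : M.PosSemidef) (i j : Fin d) :
    0 ≤ frob (Matrix.single i j 1 + 1) M := by
  have h1 : frob (Matrix.single i j 1) M = M i j := by
    simp [frob, Matrix.single_apply, ite_and]
  have h2 : frob 1 M = ∑ k, M k k := by
    simp [frob, Matrix.one_apply]
  rw [frob_add_left, h1, h2]
  have hd : ∀ k, 0 ≤ M k k := fun k => hM.diag_nonneg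
  by_cases hij : i = j
  · subst hij
    exact add_nonneg (hd i) (Finset.sum_nonneg fun k _ => hd k)
  · have hs : M i i + M j j ≤ ∑ k, M k k := by
      have := Finset.sum_le_sum_of_subset_of_nonneg (s := {i, j}) (t := Finset.univ)
        (f := fun k => M k k) (Finset.subset_univ _) (fun k _ _ => hd k)
      rwa [Finset.sum_pair hij] at this
    have hsym : M j i = M i j := by
      have := hM.1.apply i j
      simpa using this
    have hq := hM.dotProduct_mulVec_nonneg (Pi.single i 1 + Pi.single j 1)
    have hq2 : 0 ≤ M i i + M i j + M j i + M j j := by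
      simp [Matrix.mulVec_add, add_dotProduct] at hq
      linarith
    rw [hsym] at hq2
    linarith [hd i, hd j]

end Matrices

/-! ### Hessians and admissible functions -/

section Adm

variable {d : ℕ}

lemma hess_add {φ ψ : Ed d → ℝ} (hφ : ContDiff ℝ 2 φ) (hψ : ContDiff ℝ 2 ψ) (x : Ed d) :
    hess (fun y => φ y + ψ y) x = hess φ x + hess ψ x := by
  ext i j
  have := iteratedFDeriv_add_apply (i := 2) (x := x) hφ.contDiffAt hψ.contDiffAt
  have h2 : (φ + ψ) = fun y => φ y + ψ y := rfl
  rw [h2] at this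
  simp [hess, this]

lemma hess_smul {φ : Ed d → ℝ} (hφ : ContDiff ℝ 2 φ) (c : ℝ) (x : Ed d) :
    hess (fun y => c * φ y) x = c • hess φ x := by
  ext i j
  have := iteratedFDeriv_const_smul_apply (i := 2) (a := c) (x := x) hφ.contDiffAt
  have h2 : (c • φ) = fun y => c * φ y := rfl
  rw [h2] at this
  simp [hess, this]

lemma continuous_hess {φ : Ed d → ℝ} (hφ : ContDiff ℝ 2 φ) : Continuous (hess φ) := by
  refine continuous_matrix fun i j => ?_
  have h : Continuous (iteratedFDeriv ℝ 2 φ) := hφ.continuous_iteratedFDeriv (by norm_num)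
  exact (continuous_eval_const (F := ContinuousMultilinearMap ℝ (fun _ : Fin 2 => Ed d) ℝ)
    ![EuclideanSpace.single i 1, EuclideanSpace.single j 1]).comp h

lemma IsC2c.add {φ ψ : Ed d → ℝ} (hφ : IsC2c φ) (hψ : IsC2c ψ) :
    IsC2c (fun y => φ y + ψ y) := ⟨hφ.1.add hψ.1, hφ.2.add hψ.2⟩

lemma IsC2c.smul {φ : Ed d → ℝ} (hφ : IsC2c φ) (c : ℝ) :
    IsC2c (fun y => c * φ y) := ⟨contDiff_const.mul hφ.1, hφ.2.mul_left⟩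

lemma IsC2c.zero : IsC2c (fun _ : Ed d => (0 : ℝ)) :=
  ⟨contDiff_const, HasCompactSupport.zero⟩

lemma IsC2c.integrable {φ : Ed d → ℝ} (hφ : IsC2c φ) (μ : Measure (Ed d)) [IsFiniteMeasure μ] :
    Integrable φ μ := hφ.1.continuous.integrable_of_hasCompactSupport hφ.2

/-- A cutoff equal to one near a bounded set. -/
lemma exists_cutoff {X : Set (Ed d)} (hX : Bornology.IsBounded X) :
    ∃ η : Ed d → ℝ, IsC2c η ∧ (∀ x ∈ X, η x = 1) ∧ ∀ x ∈ X, hess η x = 0 := by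
  obtain ⟨R, hR⟩ := hX.subset_ball (0 : Ed d)
  let b : ContDiffBump (0 : Ed d) := ⟨max R 1, max R 1 + 1, by positivity, by linarith⟩
  have hb : ∀ x ∈ X, (b : Ed d → ℝ) =ᶠ[𝓝 x] fun _ => (1 : ℝ) := by
    intro x hx
    have : x ∈ Metric.ball (0 : Ed d) (max R 1) :=
      Metric.ball_subset_ball (le_max_left _ _) (hR hx)
    exact b.eventuallyEq_one_of_mem_ball this
  refine ⟨b, ⟨b.contDiff, b.hasCompactSupport⟩, fun x hx => (hb x hx).eq_of_nhds, fun x hx => ?_⟩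
  ext i j
  simp only [hess]
  rw [(hb x hx).iteratedFDeriv ℝ 2 |>.eq_of_nhds]
  simp [iteratedFDeriv_const_of_ne]

/-- Admissible dual functions. -/
def Adm (f : Matd d → ℝ≥0∞) (X : Set (Ed d)) (χ : Ed d → ℝ) : Prop :=
  IsC2c χ ∧ ∀ x ∈ X, InDom f ((1 / 2 : ℝ) • hess χ x)

lemma Adm.comb {f : Matd d → ℝ≥0∞} {X : Set (Ed d)} {φ ψ : Ed d → ℝ} {a b : ℝ}
    (hφ : Adm f X φ) (hψ : Adm f X ψ) (ha : 0 ≤ a) (hb : 0 ≤ b) (hab : a + b ≤ 1) :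
    Adm f X (fun y => a * φ y + b * ψ y) := by
  refine ⟨(hφ.1.smul a).add (hψ.1.smul b), fun x hx => ?_⟩
  rw [hess_add (hφ.1.smul a).1 (hψ.1.smul b).1, hess_smul hφ.1.1, hess_smul hψ.1.1, smul_add,
    smul_comm, smul_comm (1 / 2 : ℝ) b]
  exact InDom.comb ha hb hab (hφ.2 x hx) (hψ.2 x hx)

lemma Adm.zero (f : Matd d → ℝ≥0∞) (X : Set (Ed d)) : Adm f X (fun _ => 0) := by
  refine ⟨IsC2c.zero, fun x _ => ?_⟩
  have : hess (fun _ : Ed d => (0 : ℝ)) x = 0 := by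
    have := hess_smul (d := d) (φ := fun _ => (0 : ℝ)) contDiff_const 0 x
    simpa using this
  rw [this, smul_zero]
  exact InDom.zero f

/-- Weak duality. -/
lemma weak_duality {f : Matd d → ℝ≥0∞} {X : Set (Ed d)} {χ : Ed d → ℝ} (hχ : Adm f X χ)
    (μ ν : Measure (Ed d)) :
    ENNReal.ofReal (∫ x, χ x ∂ν - ∫ x, χ x ∂μ) ≤ Fstat f X μ ν := by
  refine le_sInf ?_
  rintro c ⟨m, ρ, ⟨hfin, hmX, -, hcomp⟩, rfl⟩
  rw [← hcomp χ hχ.1]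
  have hae : ∀ᵐ x ∂m, x ∈ X := by
    rw [ae_iff]; exact hmX
  by_cases hi : Integrable (fun x => (1 / 2 : ℝ) * frob (hess χ x) (ρ x)) m
  · calc ENNReal.ofReal (∫ x, (1 / 2 : ℝ) * frob (hess χ x) (ρ x) ∂m)
        ≤ ∫⁻ x, ENNReal.ofReal ((1 / 2 : ℝ) * frob (hess χ x) (ρ x)) ∂m := by
          rw [integral_eq_lintegral_pos_part_sub_lintegral_neg_part hi]
          refine (ENNReal.ofReal_le_ofReal (sub_le_self _ ENNReal.toReal_nonneg)).trans ?_
          exact ENNReal.ofReal_toReal_le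
      _ ≤ ∫⁻ x, f (ρ x) ∂m := by
          refine lintegral_mono_ae ?_
          filter_upwards [hae] with x hx
          rw [← frob_smul_left]
          exact hχ.2 x hx (ρ x)
  · rw [integral_undef hi]; simp

end Adm

/-! ### Strong duality for the static problem -/

section Strong

variable {d : ℕ}

lemma strong_functional {f : Matd d → ℝ≥0∞} (hA1 : CostA1 f) {X : Set (Ed d)}
    (hX : IsCompact X) (μ ν : Measure (Ed d)) [IsFiniteMeasure μ] [IsFiniteMeasure ν]
    (D : ℝ) (hD : 0 ≤ D) (h : ∀ χ, Adm f X χ → ∫ x, χ x ∂ν - ∫ x, χ x ∂μ ≤ D) :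
    ∃ L : C(X, Matd d) →ₗ[ℝ] ℝ,
      (∀ φ, IsC2c φ → ∀ k : C(X, Matd d), (∀ y : X, k y = (1 / 2 : ℝ) • hess φ y) →
        L k = ∫ x, φ x ∂ν - ∫ x, φ x ∂μ) ∧
      (∀ Ξ : C(X, Matd d), (∀ y, InDom f (Ξ y)) → L Ξ ≤ D) := by
  set I : (Ed d → ℝ) → ℝ := fun φ => ∫ x, φ x ∂ν - ∫ x, φ x ∂μ with hI
  have hIadd : ∀ φ ψ, IsC2c φ → IsC2c ψ → I (fun y => φ y + ψ y) = I φ + I ψ := by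
    intro φ ψ hφ hψ
    simp only [hI]
    rw [integral_add (hφ.integrable ν) (hψ.integrable ν),
      integral_add (hφ.integrable μ) (hψ.integrable μ)]
    ring
  have hIsm : ∀ (c : ℝ) φ, I (fun y => c * φ y) = c * I φ := by
    intro c φ
    simp only [hI]
    rw [integral_const_mul, integral_const_mul]
    ring
  have hI0 : I (fun _ => 0) = 0 := by simp [hI]
  have hh0 : ∀ x, hess (fun _ : Ed d => (0 : ℝ)) x = 0 := fun x => by
    simpa using hess_smul (d := d) (φ := fun _ => (0 : ℝ)) contDiff_const 0 x
  obtain ⟨c, hc, hcoer⟩ := hA1.2.1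
  let K : C(X, Matd d) → ℝ → Prop := fun k r => ∃ φ, ∃ t : ℝ, ∃ Ξ : C(X, Matd d),
    IsC2c φ ∧ 0 ≤ t ∧ (∀ y, InDom f (Ξ y)) ∧
      (∀ y : X, k y = (1 / 2 : ℝ) • hess φ y + t • Ξ y) ∧ r = I φ + t * D
  obtain ⟨L, hL⟩ := hb_aux K
    (by
      rintro k r k' r' ⟨φ, t, Ξ, hφ, ht, hΞ, hk, rfl⟩ ⟨φ', t', Ξ', hφ', ht', hΞ', hk', rfl⟩
      rcases (add_nonneg ht ht').eq_or_lt with h0 | h0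
      · have e1 : t = 0 := by linarith
        have e2 : t' = 0 := by linarith
        subst e1 e2
        refine ⟨_, 0, Ξ, hφ.add hφ', le_rfl, hΞ, fun y => ?_, ?_⟩
        · rw [hess_add hφ.1 hφ'.1, ContinuousMap.add_apply, hk, hk']
          simp
        · rw [hIadd _ _ hφ hφ']; ring
      · refine ⟨_, t + t', (t / (t + t')) • Ξ + (t' / (t + t')) • Ξ', hφ.add hφ', h0.le,
          fun y => ?_, fun y => ?_, ?_⟩
        · exact InDom.comb (div_nonneg ht h0.le) (div_nonneg ht' h0.le)
            (by rw [← add_div, div_self h0.ne']) (hΞ y) (hΞ' y)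
        · rw [hess_add hφ.1 hφ'.1, ContinuousMap.add_apply, hk, hk', ContinuousMap.add_apply,
            ContinuousMap.smul_apply, ContinuousMap.smul_apply, smul_add, smul_add, smul_smul,
            smul_smul, mul_div_cancel₀ _ h0.ne', mul_div_cancel₀ _ h0.ne']
          abel
        · rw [hIadd _ _ hφ hφ']; ring)
    (by
      rintro s hs k r ⟨φ, t, Ξ, hφ, ht, hΞ, hk, rfl⟩
      refine ⟨_, s * t, Ξ, hφ.smul s, mul_nonneg hs.le ht, hΞ, fun y => ?_, ?_⟩
      · rw [ContinuousMap.smul_apply, hk, hess_smul hφ.1, smul_add, smul_smul s t, smul_comm s]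
      · rw [hIsm]; ring)
    (by
      intro k
      have : CompactSpace X := isCompact_iff_compactSpace.1 hX
      obtain ⟨C, hC⟩ := (isCompact_range (continuous_matnorm.comp k.continuous)).bddAbove
      have hC' : ∀ y, matnorm (k y) ≤ C := fun y => hC ⟨y, rfl⟩
      set t : ℝ := (|C| + 1) / c with ht
      have ht0 : 0 < t := by positivity
      refine ⟨_, fun _ => 0, t, t⁻¹ • k, IsC2c.zero, ht0.le, fun y => ?_, fun y => ?_, rfl⟩
      · refine inDom_of_matnorm hcoer ?_
        rw [ContinuousMap.smul_apply, matnorm_smul, abs_of_pos (inv_pos.2 ht0), inv_mul_le_iff₀ ht0,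
          ht, div_mul_cancel₀ _ hc.ne']
        linarith [hC' y, le_abs_self C]
      · rw [hh0, ContinuousMap.smul_apply, smul_smul, mul_inv_cancel₀ ht0.ne']
        simp)
    (by
      rintro r ⟨φ, t, Ξ, hφ, ht, hΞ, hk, rfl⟩
      rcases ht.eq_or_lt with h0 | h0
      · subst h0
        have hz : ∀ y : X, (1 / 2 : ℝ) • hess φ y = 0 := fun y => by
          have := hk y
          simpa using this.symm
        have hb : ∀ n : ℝ, -n * I φ ≤ D := by
          intro n
          rw [← hIsm]
          refine h _ ⟨hφ.smul _, fun x hx => ?_⟩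
          rw [hess_smul hφ.1, smul_comm, hz ⟨x, hx⟩, smul_zero]
          exact InDom.zero f
        by_contra hneg
        have hneg' : I φ < 0 := by simpa using hneg
        have := hb ((D + 1) / (-I φ))
        have e : -((D + 1) / (-I φ)) * I φ = D + 1 := by
          have := hneg'.ne
          field_simp
        rw [e] at this
        linarith
      · have : Adm f X (fun y => (-t⁻¹) * φ y) := by
          refine ⟨hφ.smul _, fun x hx => ?_⟩
          rw [hess_smul hφ.1, smul_comm]
          have hk' := hk ⟨x, hx⟩
          have e : (1 / 2 : ℝ) • hess φ x = -(t • Ξ ⟨x, hx⟩) := by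
            rw [eq_neg_iff_add_eq_zero]; exact hk'.symm
          rw [e, neg_smul, smul_neg, neg_neg, smul_smul, inv_mul_cancel₀ h0.ne', one_smul]
          exact hΞ _
        have h1 : I (fun y => (-t⁻¹) * φ y) ≤ D := h _ this
        rw [hIsm, neg_mul, ← div_eq_inv_mul, ← neg_div, div_le_iff₀ h0] at h1
        linarith)
  refine ⟨L, fun φ hφ k hk => ?_, fun Ξ hΞ => ?_⟩
  · have h1 : L k ≤ I φ := hL k _ ⟨φ, 0, 0, hφ, le_rfl, fun y => InDom.zero f,
      fun y => by simp [hk], by simp⟩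
    have h2 : L (-k) ≤ I (fun y => (-1) * φ y) := hL (-k) _ ⟨_, 0, 0, hφ.smul (-1), le_rfl,
      fun y => InDom.zero f, fun y => by
        rw [hess_smul hφ.1, ContinuousMap.neg_apply, hk]
        simp, by simp⟩
    rw [hIsm, map_neg] at h2
    exact le_antisymm h1 (by linarith)
  · exact hL Ξ D ⟨fun _ => 0, 1, Ξ, IsC2c.zero, zero_le_one, hΞ,
      fun y => by simp [hh0], by simp [hI0]⟩

lemma strong_density {f : Matd d → ℝ≥0∞} (hA1 : CostA1 f) {Y : Type*} [MetricSpace Y]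
    [CompactSpace Y] [MeasurableSpace Y] [BorelSpace Y]
    (D : ℝ) (L : C(Y, Matd d) →ₗ[ℝ] ℝ)
    (hL : ∀ Ξ : C(Y, Matd d), (∀ y, InDom f (Ξ y)) → L Ξ ≤ D) :
    ∃ (m : Measure Y) (ρ : Y → Matd d), IsFiniteMeasure m ∧
      (∀ i j, Measurable fun y => ρ y i j) ∧ (∀ i j, Integrable (fun y => ρ y i j) m) ∧
      ∀ h : C(Y, Matd d), L h = ∫ y, frob (h y) (ρ y) ∂m := by
  -- multiplication of a fixed matrix by a scalar function
  let mulN : Matd d → (C(Y, ℝ) →ₗ[ℝ] C(Y, Matd d)) := fun N =>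
    { toFun := fun g => ⟨fun y => g y • N, g.continuous.smul continuous_const⟩
      map_add' := fun g g' => by ext1 y; exact add_smul _ _ _
      map_smul' := fun c g => by ext1 y; exact mul_smul _ _ _ }
  have hpos : ∀ N : Matd d, (∀ M : Matd d, M.PosSemidef → 0 ≤ frob N M) →
      ∀ g : C(Y, ℝ), 0 ≤ g → 0 ≤ (L.comp (mulN N)) g := by
    intro N hN g hg
    have hb : ∀ n : ℝ, 0 ≤ n → -n * (L.comp (mulN N)) g ≤ D := by
      intro n hn
      rw [← smul_eq_mul, ← map_smul]
      refine hL _ fun y => inDom_of_neg hA1 fun M hM => ?_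
      have e : (mulN N (-n • g)) y = (-n * g y) • N := rfl
      rw [e, frob_smul_left]
      have := hN M hM
      have hgy : 0 ≤ g y := hg y
      nlinarith [mul_nonneg (mul_nonneg hn hgy) this]
    by_contra hneg
    push Not at hneg
    set I := (L.comp (mulN N)) g
    have := hb ((|D| + 1) / (-I)) (div_nonneg (by positivity) (by linarith))
    have e : -((|D| + 1) / (-I)) * I = |D| + 1 := by
      have := hneg.ne
      field_simp
    rw [e] at this
    linarith [le_abs_self D]
  have h1pos : ∀ M : Matd d, M.PosSemidef → 0 ≤ frob 1 M := by
    intro M hM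
    have h2 : frob 1 M = ∑ k, M k k := by simp [frob, Matrix.one_apply]
    rw [h2]
    exact Finset.sum_nonneg fun k _ => hM.diag_nonneg
  obtain ⟨τ, hτf, hτ⟩ := riesz_aux (L.comp (mulN 1)) (hpos 1 h1pos)
  have hσ' : ∀ i j : Fin d, ∃ σ : Measure Y, IsFiniteMeasure σ ∧ ∀ g : C(Y, ℝ), ∫ y, g y ∂σ =
      (L.comp (mulN (Matrix.single i j 1 + 1))) g := fun i j =>
    riesz_aux _ (hpos _ fun M hM => frob_single_add_one hM i j)
  choose σ hσf hσ using hσ'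
  set m : Measure Y := τ + ∑ i, ∑ j, σ i j with hm
  have hmf : IsFiniteMeasure m := by
    rw [hm]; infer_instance
  have hτm : τ ≪ m := by
    rw [hm]; exact Measure.AbsolutelyContinuous.rfl.add_right _
  have hσm : ∀ i j, σ i j ≪ m := by
    intro i j
    refine Measure.absolutelyContinuous_of_le ?_
    calc σ i j ≤ ∑ j, σ i j :=
          Finset.single_le_sum (f := fun j => σ i j) (fun _ _ => bot_le) (Finset.mem_univ j)
      _ ≤ ∑ i, ∑ j, σ i j :=
          Finset.single_le_sum (f := fun i => ∑ j, σ i j) (fun _ _ => bot_le) (Finset.mem_univ i)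
      _ ≤ m := by rw [hm]; exact Measure.le_add_left le_rfl
  set ρ : Y → Matd d := fun y i j =>
    ((σ i j).rnDeriv m y).toReal - (τ.rnDeriv m y).toReal with hρ
  have hρi : ∀ i j, Integrable (fun y => ρ y i j) m := fun i j =>
    Measure.integrable_toReal_rnDeriv.sub Measure.integrable_toReal_rnDeriv
  refine ⟨m, ρ, hmf, fun i j => ?_, hρi, fun h => ?_⟩
  · exact (Measure.measurable_rnDeriv _ _).ennreal_toReal.sub
      (Measure.measurable_rnDeriv _ _).ennreal_toReal
  · let hij : Fin d → Fin d → C(Y, ℝ) := fun i j =>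
      ⟨fun y => h y i j, h.continuous.matrix_elem i j⟩
    have hdec : h = ∑ i, ∑ j, mulN (Matrix.single i j 1) (hij i j) := by
      ext1 y
      rw [ContinuousMap.sum_apply]
      conv_lhs => rw [Matrix.matrix_eq_sum_single (h y)]
      refine Finset.sum_congr rfl fun i _ => ?_
      rw [ContinuousMap.sum_apply]
      refine Finset.sum_congr rfl fun j _ => ?_
      simp [mulN, hij, Matrix.smul_single]
    have hbd : ∀ i j, ∃ C, ∀ y, ‖hij i j y‖ ≤ C := fun i j => ⟨‖hij i j‖, (hij i j).norm_coe_le_norm⟩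
    have hintg : ∀ i j, ∀ κ : Measure Y, IsFiniteMeasure κ →
        Integrable (fun y => (κ.rnDeriv m y).toReal * hij i j y) m := by
      intro i j κ _
      obtain ⟨C, hC⟩ := hbd i j
      exact Measure.integrable_toReal_rnDeriv.mul_bdd
        (hij i j).continuous.aestronglyMeasurable (Eventually.of_forall hC)
    have hone : ∀ i j, L (mulN (Matrix.single i j 1) (hij i j)) =
        ∫ y, h y i j * ρ y i j ∂m := by
      intro i j
      have e1 : mulN (Matrix.single i j 1) (hij i j) =
          mulN (Matrix.single i j 1 + 1) (hij i j) - mulN 1 (hij i j) := by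
        ext1 y
        simp [mulN, smul_add]
      have e2 := hσ i j (hij i j)
      have e3 := hτ (hij i j)
      rw [LinearMap.comp_apply] at e2 e3
      rw [e1, map_sub, ← e2, ← e3, ← integral_toReal_rnDeriv_mul (hσm i j),
        ← integral_toReal_rnDeriv_mul hτm,
        ← integral_sub (hintg i j _ (hσf i j)) (hintg i j _ hτf)]
      refine integral_congr_ae (Eventually.of_forall fun y => ?_)
      simp only [hρ, hij, ContinuousMap.coe_mk]
      ring
    have hint2 : ∀ i j, Integrable (fun y => h y i j * ρ y i j) m := by
      intro i j
      refine ((hintg i j _ (hσf i j)).sub (hintg i j _ hτf)).congr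
        (Eventually.of_forall fun y => ?_)
      simp only [hρ, hij, ContinuousMap.coe_mk, Pi.sub_apply]
      ring
    conv_lhs => rw [hdec]
    rw [map_sum]
    simp only [map_sum, hone, frob]
    rw [integral_finsetSum _ fun i _ => integrable_finsetSum _ fun j _ => hint2 i j]
    refine Finset.sum_congr rfl fun i _ => ?_
    rw [integral_finsetSum _ fun j _ => hint2 i j]

lemma strong_cost {f : Matd d → ℝ≥0∞} {Y : Type*} [MetricSpace Y]
    [CompactSpace Y] [MeasurableSpace Y] [BorelSpace Y]
    (D : ℝ) (L : C(Y, Matd d) →ₗ[ℝ] ℝ)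
    (hL2 : ∀ Ξ : C(Y, Matd d), (∀ y, InDom f (Ξ y)) → L Ξ ≤ D)
    (m : Measure Y) [IsFiniteMeasure m] (ρ : Y → Matd d)
    (hLm : ∀ h : C(Y, Matd d), L h = ∫ y, frob (h y) (ρ y) ∂m)
    (B : ℕ → Matd d) (hB : ∀ k, InDom f (B k))
    (hgm : ∀ k, Measurable fun y => frob (B k) (ρ y))
    (hgi : ∀ k, Integrable (fun y => frob (B k) (ρ y)) m) :
    ∫⁻ y, ⨆ k, ENNReal.ofReal (frob (B k) (ρ y)) ∂m ≤ ENNReal.ofReal D := by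
  refine part_aux m (fun k y => frob (B k) (ρ y)) hgm hgi D fun n w hw0 hw1 => ?_
  obtain ⟨Ξ, hΞe⟩ : ∃ Ξ : C(Y, Matd d), ∀ y, Ξ y = ∑ k ∈ Finset.range n, w k y • B k :=
    ⟨⟨fun y => ∑ k ∈ Finset.range n, w k y • B k,
      continuous_finsetSum _ fun k _ => (w k).continuous.smul continuous_const⟩, fun y => rfl⟩
  have hΞ : L Ξ ≤ D := by
    refine hL2 Ξ fun y => ?_
    rw [hΞe]
    exact InDom.sum _ (fun k => w k y) B (fun k _ => hw0 k y) (hw1 y) (fun k _ => hB k)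
  rw [hLm] at hΞ
  have e : ∀ y, frob (Ξ y) (ρ y) = ∑ k ∈ Finset.range n, w k y * frob (B k) (ρ y) := by
    intro y
    rw [hΞe, frob_sum_left]
    simp_rw [frob_smul_left]
  simp_rw [e] at hΞ
  have hi : ∀ k ∈ Finset.range n, Integrable (fun y => w k y * frob (B k) (ρ y)) m :=
    fun k _ => (hgi k).bdd_mul (w k).continuous.aestronglyMeasurable
      (Eventually.of_forall fun y => (w k).norm_coe_le_norm y)
  rwa [integral_finsetSum _ hi] at hΞ

lemma strong_duality {f : Matd d → ℝ≥0∞} (hA1 : CostA1 f) (hA2 : CostA2 f) {X : Set (Ed d)}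
    (hX : IsCompact X) (μ ν : Measure (Ed d)) [IsFiniteMeasure μ] [IsFiniteMeasure ν]
    (D : ℝ) (hD : 0 ≤ D) (h : ∀ χ, Adm f X χ → ∫ x, χ x ∂ν - ∫ x, χ x ∂μ ≤ D) :
    Fstat f X μ ν ≤ ENNReal.ofReal D := by
  have hXc : CompactSpace X := isCompact_iff_compactSpace.1 hX
  obtain ⟨L, hL1, hL2⟩ := strong_functional hA1 hX μ ν D hD h
  obtain ⟨m, ρ, hmf, hρm, hρi, hLm⟩ := strong_density hA1 D L hL2
  obtain ⟨B, hB, hfB⟩ := bipolar_seq hA1 hA2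
  have hgm : ∀ k, Measurable fun y => frob (B k) (ρ y) := by
    intro k
    unfold frob
    exact Finset.measurable_fun_sum _ fun i _ => Finset.measurable_fun_sum _ fun j _ =>
      measurable_const.mul (hρm i j)
  have hgi : ∀ k, Integrable (fun y => frob (B k) (ρ y)) m := by
    intro k
    unfold frob
    exact integrable_finsetSum _ fun i _ => integrable_finsetSum _ fun j _ =>
      (hρi i j).const_mul _
  have hcost : ∫⁻ y, f (ρ y) ∂m ≤ ENNReal.ofReal D := by
    simp_rw [hfB]
    exact strong_cost D L hL2 m ρ hLm B hB hgm hgi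
  have hfin : ∀ᵐ y ∂m, f (ρ y) < ⊤ := by
    refine ae_lt_top ?_ (hcost.trans_lt ENNReal.ofReal_lt_top).ne
    simp_rw [hfB]
    exact Measurable.iSup fun k => (hgm k).ennreal_ofReal
  have hpsd : ∀ᵐ y ∂m, (ρ y).PosSemidef := by
    filter_upwards [hfin] with y hy using hA1.1 _ hy.ne
  let ρ' : Ed d → Matd d := fun x =>
    if hx : x ∈ X then (if (ρ ⟨x, hx⟩).PosSemidef then ρ ⟨x, hx⟩ else 0) else 0
  have hρ' : ∀ᵐ y : X ∂m, ρ' (y : Ed d) = ρ y := by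
    filter_upwards [hpsd] with y hy
    simp [ρ', hy]
  have hemb : MeasurableEmbedding (Subtype.val : X → Ed d) :=
    MeasurableEmbedding.subtype_coe hX.measurableSet
  have hcl : ∫⁻ x, f (ρ' x) ∂(m.map Subtype.val) ≤ ENNReal.ofReal D := by
    rw [hemb.lintegral_map]
    refine le_trans (le_of_eq (lintegral_congr_ae ?_)) hcost
    filter_upwards [hρ'] with y hy
    rw [hy]
  suffices hc : IsStaticCompetitor X μ ν (m.map Subtype.val) ρ' from
    (sInf_le ⟨_, _, hc, rfl⟩ : Fstat f X μ ν ≤ _).trans hcl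
  refine ⟨?_, ?_, ?_, ?_⟩
  · exact Measure.isFiniteMeasure_map m _
  · rw [hemb.map_apply]
    simp
  · intro x
    simp only [ρ']
    split_ifs with h1 h2
    · exact h2
    · exact Matrix.PosSemidef.zero
    · exact Matrix.PosSemidef.zero
  · intro φ hφ
    rw [hemb.integral_map]
    have hck : Continuous fun y : X => hess φ y :=
      (continuous_hess hφ.1).comp continuous_subtype_val
    let k : C(X, Matd d) := ⟨fun y => (1 / 2 : ℝ) • hess φ y,
      hck.const_smul (1 / 2 : ℝ)⟩
    rw [← hL1 φ hφ k (fun y => rfl), hLm]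
    refine integral_congr_ae ?_
    filter_upwards [hρ'] with y hy
    rw [hy, ← frob_smul_left]
    rfl

end Strong

/-! ### Smooth `G`-concave functions are admissible -/

section Smooth

variable {d : ℕ}

lemma second_order {g : Ed d → ℝ} (hg : ContDiff ℝ 2 g) {z : Ed d} (hz : IsLocalMax g z)
    (v : Ed d) : fderiv ℝ (fderiv ℝ g) z v v ≤ 0 := by
  set h : ℝ → ℝ := fun t => g (z + t • v) with hh
  have hline : ∀ t : ℝ, HasDerivAt (fun t : ℝ => z + t • v) v t := fun t => by
    simpa using ((hasDerivAt_id t).smul_const v).const_add z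
  have hg1 : Differentiable ℝ g := hg.differentiable (by norm_num)
  have hg2 : Differentiable ℝ (fderiv ℝ g) :=
    (hg.fderiv_right (m := 1) (by norm_num)).differentiable (by norm_num)
  have hd1 : ∀ t, HasDerivAt h (fderiv ℝ g (z + t • v) v) t := fun t =>
    (hg1 _).hasFDerivAt.comp_hasDerivAt t (hline t)
  have hd1' : deriv h = fun t => fderiv ℝ g (z + t • v) v := funext fun t => (hd1 t).deriv
  have hd2 : HasDerivAt (deriv h) (fderiv ℝ (fderiv ℝ g) z v v) 0 := by
    rw [hd1']
    have h1 : HasDerivAt (fun t : ℝ => fderiv ℝ g (z + t • v))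
        (fderiv ℝ (fderiv ℝ g) (z + (0 : ℝ) • v) v) 0 :=
      (hg2 _).hasFDerivAt.comp_hasDerivAt (0 : ℝ) (hline 0)
    have h2 := h1.clm_apply (hasDerivAt_const (0 : ℝ) v)
    simpa using h2
  have hmax : IsLocalMax h 0 := by
    have hc : ContinuousAt (fun t : ℝ => z + t • v) 0 := (hline 0).continuousAt
    have hz' : IsLocalMax g (z + (0 : ℝ) • v) := by simpa using hz
    exact IsLocalMax.comp_continuous (g := fun t : ℝ => z + t • v) hz' hc
  by_contra hcon
  push Not at hcon
  have hmin : IsLocalMin h 0 :=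
    isLocalMin_of_deriv_deriv_pos (by rw [hd2.deriv]; exact hcon) hmax.deriv_eq_zero
      (hd1 0).continuousAt
  have hconst : h =ᶠ[𝓝 0] fun _ => h 0 := by
    filter_upwards [hmax, hmin] with t h1 h2 using le_antisymm h1 h2
  have h3 : deriv h =ᶠ[𝓝 0] fun _ => 0 := by
    have := hconst.deriv
    simpa using this
  have h4 : deriv (deriv h) 0 = 0 := by
    rw [h3.deriv_eq]; simp
  rw [hd2.deriv] at h4
  linarith

lemma second_order_frob {g : Ed d → ℝ} (hg : ContDiff ℝ 2 g) {z : Ed d} (hz : IsLocalMax g z)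
    {M : Matd d} (hM : M.PosSemidef) : frob (hess g z) M ≤ 0 := by
  obtain ⟨B, hB⟩ : ∃ B : Matd d, M = B.conjTranspose * B := by
    open scoped MatrixOrder in
    exact CStarAlgebra.nonneg_iff_eq_star_mul_self.1 hM.nonneg
  have hMij : ∀ i j, M i j = ∑ k, B k i * B k j := by
    intro i j
    rw [hB, Matrix.mul_apply]
    simp
  set T := fderiv ℝ (fderiv ℝ g) z with hT
  have hh : ∀ i j, hess g z i j = T (EuclideanSpace.single i 1) (EuclideanSpace.single j 1) := by
    intro i j
    simp only [hess]
    rw [iteratedFDeriv_two_apply]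
    simp [hT]
  let b : Fin d → Ed d := fun k => ∑ i, B k i • EuclideanSpace.single i (1 : ℝ)
  have hb : ∀ k, T (b k) (b k) = ∑ i, ∑ j, hess g z i j * (B k i * B k j) := by
    intro k
    simp only [b, map_sum, map_smul, _root_.sum_apply, _root_.smul_apply,
      smul_eq_mul, hh, Finset.mul_sum]
    rw [Finset.sum_comm]
    refine Finset.sum_congr rfl fun i _ => Finset.sum_congr rfl fun j _ => ?_
    ring
  have : frob (hess g z) M = ∑ k, T (b k) (b k) := by
    simp_rw [hb, frob, hMij, Finset.mul_sum]
    conv_rhs => rw [Finset.sum_comm]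
    refine Finset.sum_congr rfl fun i _ => ?_
    rw [Finset.sum_comm]
  rw [this]
  exact Finset.sum_nonpos fun k _ => second_order hg hz _

lemma hb_touch {f : Matd d → ℝ≥0∞} (hA1 : CostA1 f) (hA2 : CostA2 f) {X : Set (Ed d)}
    (hX : IsCompact X) {ψ : Ed d → ℝ} (hψ : IsC2c ψ) {x : Ed d} {ε : ℝ} (hε : 0 < ε)
    (hG : GTrans f X (fun y => -ψ y) x = ((-ψ x : ℝ) : EReal)) :
    ∃ χ, Adm f X χ ∧ ∀ y ∈ X, ψ y - χ y ≤ ψ x - χ x + ε := by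
  have hXc : CompactSpace X := isCompact_iff_compactSpace.1 hX
  by_contra hcon
  push Not at hcon
  let s : (Ed d → ℝ) → Ed d → ℝ := fun χ y => χ y - χ x - ψ y + ψ x + ε
  have hs : ∀ χ, Adm f X χ → ∃ y : X, s χ y < 0 := by
    intro χ hχ
    obtain ⟨y, hy, h⟩ := hcon χ hχ
    exact ⟨⟨y, hy⟩, by simp only [s]; linarith⟩
  let K : C(X, ℝ) → ℝ → Prop := fun h r => ∃ t : ℝ, ∃ χ, 0 ≤ t ∧ Adm f X χ ∧
    ∀ y : X, h y ≤ r + t * s χ y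
  obtain ⟨L, hL⟩ := hb_aux K
    (by
      rintro k r k' r' ⟨t, χ, ht, hχ, hk⟩ ⟨t', χ', ht', hχ', hk'⟩
      rcases (add_nonneg ht ht').eq_or_lt with h0 | h0
      · have e1 : t = 0 := by linarith
        have e2 : t' = 0 := by linarith
        subst e1 e2
        refine ⟨0, χ, le_rfl, hχ, fun y => ?_⟩
        rw [ContinuousMap.add_apply]
        linarith [hk y, hk' y]
      · have hab : t / (t + t') + t' / (t + t') = 1 := by rw [← add_div, div_self h0.ne']
        refine ⟨t + t', _, h0.le, hχ.comb hχ' (div_nonneg ht h0.le) (div_nonneg ht' h0.le) hab.le,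
          fun y => ?_⟩
        have e : (t + t') * s (fun y => t / (t + t') * χ y + t' / (t + t') * χ' y) y
            = t * s χ y + t' * s χ' y := by
          simp only [s]
          field_simp
          ring
        rw [ContinuousMap.add_apply, e]
        linarith [hk y, hk' y])
    (by
      rintro c hc k r ⟨t, χ, ht, hχ, hk⟩
      refine ⟨c * t, χ, mul_nonneg hc.le ht, hχ, fun y => ?_⟩
      rw [ContinuousMap.smul_apply, smul_eq_mul, mul_assoc, ← mul_add]
      exact mul_le_mul_of_nonneg_left (hk y) hc.le)
    (by
      intro k
      refine ⟨‖k‖, 0, _, le_rfl, Adm.zero f X, fun y => ?_⟩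
      rw [zero_mul, add_zero]
      exact (le_abs_self _).trans (k.norm_coe_le_norm y))
    (by
      rintro r ⟨t, χ, ht, hχ, hk⟩
      obtain ⟨y, hy⟩ := hs χ hχ
      have := hk y
      rw [ContinuousMap.zero_apply] at this
      nlinarith)
  have hLc : ∀ (h : C(X, ℝ)) (r : ℝ), (∀ y, h y ≤ r) → L h ≤ r := fun h r hr =>
    hL h r ⟨0, _, le_rfl, Adm.zero f X, fun y => by simpa using hr y⟩
  obtain ⟨m, hmf, hm⟩ := riesz_aux L (by
    intro g hg
    have := hLc (-g) 0 (fun y => by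
      have : 0 ≤ g y := hg y
      rw [ContinuousMap.neg_apply]
      linarith)
    rw [map_neg] at this
    linarith)
  have hemb : MeasurableEmbedding (Subtype.val : X → Ed d) :=
    MeasurableEmbedding.subtype_coe hX.measurableSet
  have hm1 : m.real univ = 1 := by
    have h1 := hm 1
    have h2 : L 1 = 1 := by
      refine le_antisymm (hLc 1 1 fun y => le_rfl) ?_
      have := hLc (-1) (-1) fun y => le_rfl
      rw [map_neg] at this
      linarith
    rw [h2] at h1
    simpa using h1
  have hmp : IsProbabilityMeasure m := ⟨by
    rw [measureReal_def, ENNReal.toReal_eq_one_iff] at hm1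
    exact hm1⟩
  set p : Measure (Ed d) := m.map Subtype.val with hp
  have hpp : IsProbabilityMeasure p :=
    Measure.isProbabilityMeasure_map hemb.measurable.aemeasurable
  have hpX : p Xᶜ = 0 := by
    rw [hp, hemb.map_apply]; simp
  have hpi : ∀ χ, Adm f X χ → ∫ y, χ y ∂p - ∫ y, χ y ∂(Measure.dirac x)
      ≤ ∫ y, ψ y ∂p - ψ x - ε := by
    intro χ hχ
    let S : C(X, ℝ) := ⟨fun y => s χ y, by
      have := hχ.1.1.continuous
      have := hψ.1.continuous
      simp only [s]
      fun_prop⟩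
    have h1 : L S ≤ 0 := hL S 0 ⟨1, χ, zero_le_one, hχ, fun y => by simp [S]⟩
    rw [← hm] at h1
    have h2 : ∫ y, S y ∂m = ∫ y, s χ y ∂p := by
      rw [hp, hemb.integral_map]; rfl
    have h3 : ∫ y, s χ y ∂p = ∫ y, χ y ∂p - χ x - ∫ y, ψ y ∂p + ψ x + ε := by
      have i1 := hχ.1.integrable p
      have i2 := hψ.integrable p
      have i3 : Integrable (fun y => χ y - ψ y) p := i1.sub i2
      have e : ∀ y, s χ y = (χ y - ψ y) + (ψ x + ε - χ x) := fun y => by simp only [s]; ring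
      simp_rw [e]
      rw [integral_add i3 (integrable_const _), integral_sub i1 i2]
      simp
      ring
    rw [integral_dirac]
    linarith
  have hD : 0 ≤ ∫ y, ψ y ∂p - ψ x - ε := by
    have := hpi _ (Adm.zero f X)
    simpa using this
  have hGle : Gcost f X x p ≤ ENNReal.ofReal (∫ y, ψ y ∂p - ψ x - ε) :=
    strong_duality hA1 hA2 hX _ _ _ hD hpi
  have h1 : GTrans f X (fun y => -ψ y) x ≤
      ((∫ y, -ψ y ∂p : ℝ) : EReal) + (Gcost f X x p : EReal) := sInf_le ⟨p, hpp, hpX, rfl⟩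
  have h2 : ((-ψ x : ℝ) : EReal) ≤ ((∫ y, -ψ y ∂p + (∫ y, ψ y ∂p - ψ x - ε) : ℝ) : EReal) := by
    rw [← hG]
    refine h1.trans ?_
    rw [EReal.coe_add]
    refine add_le_add le_rfl ?_
    refine (EReal.coe_ennreal_le_coe_ennreal_iff.2 hGle).trans (le_of_eq ?_)
    rw [EReal.coe_ennreal_ofReal, max_eq_left hD]
  rw [EReal.coe_le_coe_iff, integral_neg] at h2
  linarith

lemma adm_of_GEq {f : Matd d → ℝ≥0∞} (hA1 : CostA1 f) (hA2 : CostA2 f) {Ω X : Set (Ed d)}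
    (hΩ : IsOpen Ω) (hXΩ : X = closure Ω)
    (hX : IsCompact X) {ψ : Ed d → ℝ} (hψ : IsC2c ψ)
    (hG : GEq f X (fun y => -ψ y) Ω) : Adm f X ψ := by
  have hΩX : Ω ⊆ X := hXΩ ▸ subset_closure
  have hcont : Continuous fun y => (1 / 2 : ℝ) • hess ψ y :=
    (continuous_hess hψ.1).const_smul (1 / 2 : ℝ)
  suffices h : ∀ x ∈ Ω, InDom f ((1 / 2 : ℝ) • hess ψ x) by
    refine ⟨hψ, fun x hx => ?_⟩
    have hcl : IsClosed {y | InDom f ((1 / 2 : ℝ) • hess ψ y)} :=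
      (InDom.closed f).preimage hcont
    rw [hXΩ] at hx
    exact closure_minimal (s := Ω) h hcl hx
  intro x hx M
  by_contra hcon
  push Not at hcon
  have hMf : f M ≠ ⊤ := hcon.ne_top
  have hM : M.PosSemidef := hA1.1 M hMf
  have hlt : (f M).toReal < frob ((1 / 2 : ℝ) • hess ψ x) M := by
    by_contra hle
    push Not at hle
    exact absurd hcon (not_lt.2 ((ENNReal.ofReal_le_iff_le_toReal hMf).2 hle))
  set δ := (frob ((1 / 2 : ℝ) • hess ψ x) M - (f M).toReal) / 2 with hδ
  have hδ0 : 0 < δ := by rw [hδ]; linarith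
  have hcf : Continuous fun y => frob ((1 / 2 : ℝ) • hess ψ y) M :=
    (continuous_frob_left M).comp hcont
  have hev : ∀ᶠ y in 𝓝 x, y ∈ Ω ∧ (f M).toReal + δ < frob ((1 / 2 : ℝ) • hess ψ y) M :=
    (hΩ.eventually_mem hx).and (hcf.continuousAt.eventually (lt_mem_nhds (by rw [hδ]; linarith)))
  obtain ⟨r, hr, hball⟩ := Metric.nhds_basis_closedBall.eventually_iff.1 hev
  let q : Ed d → ℝ := fun y => ‖y - x‖ ^ 2
  have hq : ContDiff ℝ 2 q := (contDiff_id.sub contDiff_const).norm_sq ℝ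
  have hcq : Continuous fun y => frob (hess q y) M :=
    (continuous_frob_left M).comp (continuous_hess hq)
  have hK : IsCompact (Metric.closedBall x r) := isCompact_closedBall x r
  obtain ⟨C, hC⟩ := hK.exists_bound_of_continuousOn hcq.continuousOn
  set a := δ / (|C| + 1) with ha
  have ha0 : 0 < a := by positivity
  obtain ⟨χ, hχ, hχt⟩ := hb_touch hA1 hA2 hX hψ (x := x) (ε := a * r ^ 2 / 2) (by positivity)
    (hG x hx)
  let u : Ed d → ℝ := fun y => (ψ y + (-1) * χ y) + (-a) * q y
  have hu : ContDiff ℝ 2 u := (hψ.1.add (contDiff_const.mul hχ.1.1)).add (contDiff_const.mul hq)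
  obtain ⟨z, hz, hzmax⟩ := hK.exists_isMaxOn ⟨x, Metric.mem_closedBall_self hr.le⟩
    hu.continuous.continuousOn
  have hzx : u x ≤ u z := hzmax (Metric.mem_closedBall_self hr.le)
  have hqx : q x = 0 := by simp [q]
  have hzb : z ∈ Metric.ball x r := by
    rw [Metric.mem_ball]
    refine lt_of_le_of_ne hz fun hzr => ?_
    have h1 := hχt z (hΩX (hball hz).1)
    have h2 : q z = r ^ 2 := by simp only [q]; rw [← dist_eq_norm, hzr]
    simp only [u, hqx, h2] at hzx
    have : 0 < a * r ^ 2 := by positivity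
    linarith
  have hloc : IsLocalMax u z := hzmax.isLocalMax
    (mem_of_superset (Metric.isOpen_ball.mem_nhds hzb) Metric.ball_subset_closedBall)
  have h2 := second_order_frob hu hloc hM
  have e : hess u z = (hess ψ z + (-1 : ℝ) • hess χ z) + (-a) • hess q z := by
    simp only [u]
    rw [hess_add (hψ.1.add (contDiff_const.mul hχ.1.1)) (contDiff_const.mul hq), hess_smul hq,
      hess_add hψ.1 (contDiff_const.mul hχ.1.1), hess_smul hχ.1.1]
  rw [e, frob_add_left, frob_add_left, frob_smul_left, frob_smul_left] at h2
  have h3 := (hball hz).2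
  have h4 := (ENNReal.ofReal_le_iff_le_toReal hMf).1 (hχ.2 z (hΩX (hball hz).1) M)
  rw [frob_smul_left] at h3 h4
  have h5 := hC z hz
  rw [Real.norm_eq_abs] at h5
  have h6 : a * frob (hess q z) M ≤ δ := by
    calc a * frob (hess q z) M ≤ a * (|C| + 1) :=
          mul_le_mul_of_nonneg_left (by linarith [le_abs_self (frob (hess q z) M), le_abs_self C])
            ha0.le
      _ = δ := by rw [ha]; field_simp
  linarith

end Smooth

/-! ### The envelope of admissible functions -/

section Envelope

variable {d : ℕ}

lemma Adm.add_const {f : Matd d → ℝ≥0∞} {X : Set (Ed d)} (hX : Bornology.IsBounded X)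
    {χ : Ed d → ℝ} (hχ : Adm f X χ) (c : ℝ) :
    ∃ χ', Adm f X χ' ∧ ∀ x ∈ X, χ' x = χ x + c := by
  obtain ⟨η, hη, hη1, hη0⟩ := exists_cutoff hX
  refine ⟨fun y => χ y + c * η y, ⟨hχ.1.add (hη.smul c), fun x hx => ?_⟩, fun x hx => ?_⟩
  · rw [hess_add hχ.1.1 (hη.smul c).1, hess_smul hη.1, hη0 x hx, smul_zero, add_zero]
    exact hχ.2 x hx
  · simp only [hη1 x hx, mul_one]

lemma Adm.sum {f : Matd d → ℝ≥0∞} {X : Set (Ed d)} (s : Finset ℕ) (w : ℕ → ℝ)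
    (χ : ℕ → Ed d → ℝ) (hw : ∀ k ∈ s, 0 ≤ w k) (hs : ∑ k ∈ s, w k ≤ 1)
    (hχ : ∀ k, Adm f X (χ k)) : Adm f X (fun y => ∑ k ∈ s, w k * χ k y) := by
  have key : ∀ s : Finset ℕ, IsC2c (fun y => ∑ k ∈ s, w k * χ k y) ∧
      ∀ x, hess (fun y => ∑ k ∈ s, w k * χ k y) x = ∑ k ∈ s, w k • hess (χ k) x := by
    intro s
    induction s using Finset.induction_on with
    | empty =>
      refine ⟨by simpa using IsC2c.zero, fun x => ?_⟩
      have := hess_smul (d := d) (φ := fun _ => (0 : ℝ)) contDiff_const 0 x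
      simpa using this
    | insert k s hk ih =>
      simp only [Finset.sum_insert hk]
      refine ⟨((hχ k).1.smul _).add ih.1, fun x => ?_⟩
      rw [hess_add ((hχ k).1.smul _).1 ih.1.1, hess_smul (hχ k).1.1, ih.2]
  refine ⟨(key s).1, fun x hx => ?_⟩
  rw [(key s).2, Finset.smul_sum]
  simp_rw [smul_comm (1 / 2 : ℝ)]
  exact InDom.sum s w _ hw hs fun k _ => (hχ k).2 x hx

/-- The least admissible majorant of a continuous function on `X`, extended by zero. -/
noncomputable def env (f : Matd d → ℝ≥0∞) (X : Set (Ed d)) (φ : C(X, ℝ)) (x : Ed d) : ℝ :=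
  if x ∈ X then sInf {r | ∃ χ, Adm f X χ ∧ (∀ y : X, φ y ≤ χ y) ∧ r = χ x} else 0

variable {f : Matd d → ℝ≥0∞} {X : Set (Ed d)}

lemma env_le (φ : C(X, ℝ)) {χ : Ed d → ℝ} (hχ : Adm f X χ) (h : ∀ y : X, φ y ≤ χ y)
    {x : Ed d} (hx : x ∈ X) : env f X φ x ≤ χ x := by
  rw [env, if_pos hx]
  refine csInf_le ⟨φ ⟨x, hx⟩, ?_⟩ ⟨χ, hχ, h, rfl⟩
  rintro r ⟨χ', -, h', rfl⟩
  exact h' ⟨x, hx⟩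

lemma exists_const_adm (hX : IsCompact X) (C : ℝ) : ∃ χ, Adm f X χ ∧ ∀ y ∈ X, χ y = C := by
  obtain ⟨χ, h1, h2⟩ := (Adm.zero f X).add_const hX.isBounded C
  exact ⟨χ, h1, fun y hy => by rw [h2 y hy, zero_add]⟩

lemma exists_bound (hX : IsCompact X) (φ : C(X, ℝ)) : ∃ C, ∀ y, |φ y| ≤ C := by
  have : CompactSpace X := isCompact_iff_compactSpace.1 hX
  exact ⟨‖φ‖, fun y => φ.norm_coe_le_norm y⟩

lemma env_nonempty (hX : IsCompact X) (φ : C(X, ℝ)) (x : Ed d) :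
    {r | ∃ χ, Adm f X χ ∧ (∀ y : X, φ y ≤ χ y) ∧ r = χ x}.Nonempty := by
  obtain ⟨C, hC⟩ := exists_bound hX φ
  obtain ⟨χ, h1, h2⟩ := exists_const_adm (f := f) hX C
  exact ⟨_, χ, h1, fun y => by rw [h2 y y.2]; exact (le_abs_self _).trans (hC y), rfl⟩

lemma le_env_of (hX : IsCompact X) (φ : C(X, ℝ)) {x : Ed d} (hx : x ∈ X) {r : ℝ}
    (h : ∀ χ, Adm f X χ → (∀ y : X, φ y ≤ χ y) → r ≤ χ x) : r ≤ env f X φ x := by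
  rw [env, if_pos hx]
  refine le_csInf (env_nonempty hX φ x) ?_
  rintro r ⟨χ', h1, h', rfl⟩
  exact h χ' h1 h'

lemma le_env (hX : IsCompact X) (φ : C(X, ℝ)) (x : X) : φ x ≤ env f X φ x :=
  le_env_of hX φ x.2 fun _ _ h => h x

lemma env_bound (hX : IsCompact X) (φ : C(X, ℝ)) : ∃ C : ℝ, ∀ x, |env f X φ x| ≤ C := by
  obtain ⟨C, hC⟩ := exists_bound hX φ
  refine ⟨|C|, fun x => ?_⟩
  by_cases hx : x ∈ X
  · obtain ⟨χ, h1, h2⟩ := exists_const_adm (f := f) hX C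
    have h3 := env_le φ h1 (fun y => by rw [h2 y y.2]; exact (le_abs_self _).trans (hC y)) hx
    rw [h2 x hx] at h3
    have h4 := le_env (f := f) hX φ ⟨x, hx⟩
    have h5 := hC ⟨x, hx⟩
    rw [abs_le] at h5 ⊢
    exact ⟨by linarith [le_abs_self C], by linarith [le_abs_self C]⟩
  · rw [env, if_neg hx, abs_zero]; exact abs_nonneg C

lemma env_usc (hX : IsCompact X) (φ : C(X, ℝ)) : UpperSemicontinuousOn (env f X φ) X := by
  rw [upperSemicontinuousOn_iff]
  intro x hx r hr
  rw [env, if_pos hx] at hr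
  obtain ⟨_, ⟨χ, h1, h2, rfl⟩, h3⟩ := exists_lt_of_csInf_lt (env_nonempty hX φ x) hr
  have h4 : ∀ᶠ y in 𝓝[X] x, χ y < r :=
    nhdsWithin_le_nhds (h1.1.1.continuous.continuousAt.eventually (gt_mem_nhds h3))
  filter_upwards [h4, self_mem_nhdsWithin] with y hy hyX
  exact (env_le φ h1 h2 hyX).trans_lt hy

lemma env_measurable (hX : IsCompact X) (φ : C(X, ℝ)) : Measurable (env f X φ) := by
  refine measurable_of_restrict_of_restrict_compl hX.measurableSet ?_ ?_
  · exact (upperSemicontinuousOn_iff_restrict.2 (env_usc hX φ)).measurable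
  · have : (Xᶜ : Set (Ed d)).domRestrict (env f X φ) = fun _ => 0 := by
      ext ⟨y, hy⟩
      exact if_neg hy
    rw [this]
    exact measurable_const

lemma env_integrable (hX : IsCompact X) (φ : C(X, ℝ)) (p : Measure (Ed d)) [IsFiniteMeasure p] :
    Integrable (env f X φ) p := by
  obtain ⟨C, hC⟩ := env_bound (f := f) hX φ
  exact Integrable.of_bound (env_measurable hX φ).aestronglyMeasurable C
    (Eventually.of_forall hC)

lemma gcost_self (x : Ed d) : Gcost f X x (Measure.dirac x) = 0 := by
  refine le_antisymm (sInf_le ⟨0, fun _ => 0, ⟨inferInstance, by simp,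
    fun _ => Matrix.PosSemidef.zero, fun φ _ => by simp⟩, by simp⟩) bot_le

lemma env_GEq (hX : IsCompact X) (φ : C(X, ℝ)) :
    GEq f X (fun y => -env f X φ y) X := by
  intro x hx
  refine le_antisymm ?_ (le_sInf ?_)
  · refine (sInf_le ⟨Measure.dirac x, inferInstance, ?_, rfl⟩ : GTrans f X _ x ≤ _).trans ?_
    · rw [Measure.dirac_apply' _ hX.measurableSet.compl]
      simp [hx]
    · rw [gcost_self, integral_dirac]
      simp
  · rintro c ⟨p, hp, hpX, rfl⟩
    by_cases hG : Gcost f X x p = ⊤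
    · rw [hG]; simp
    · set g := (Gcost f X x p).toReal with hg
      have hGe : (Gcost f X x p : EReal) = ((g : ℝ) : EReal) := by
        rw [hg, EReal.coe_ennreal_toReal hG]
      rw [hGe, ← EReal.coe_add, EReal.coe_le_coe_iff, integral_neg]
      have : ∫ y, env f X φ y ∂p - g ≤ env f X φ x := by
        refine le_env_of hX φ hx fun χ h1 h2 => ?_
        have h3 := weak_duality h1 (Measure.dirac x) p
        have h4 := (ENNReal.ofReal_le_iff_le_toReal hG).1 h3
        rw [integral_dirac] at h4
        have h5 : ∫ y, env f X φ y ∂p ≤ ∫ y, χ y ∂p := by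
          refine integral_mono_ae (env_integrable hX φ p) (h1.1.integrable p) ?_
          have : ∀ᵐ y ∂p, y ∈ X := by rw [ae_iff]; exact hpX
          filter_upwards [this] with y hy using env_le φ h1 h2 hy
        linarith
      linarith

end Envelope

/-! ### Existence of an optimal plan -/

section Plan

variable {d : ℕ}

lemma plan_exists {f : Matd d → ℝ≥0∞} {X : Set (Ed d)} (hX : IsCompact X) (hXne : X.Nonempty)
    (μ ν : Measure X) [IsFiniteMeasure μ] [IsFiniteMeasure ν] (hmass : μ univ = ν univ)
    (D : ℝ) (h : ∀ φ : C(X, ℝ), ∫ y : X, env f X φ y ∂ν - ∫ y : X, env f X φ y ∂μ ≤ D) :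
    ∃ γ : Measure (X × X), IsFiniteMeasure γ ∧ γ.map Prod.fst = μ ∧ γ.map Prod.snd = ν ∧
      ∀ s : C(X × X, ℝ), (∀ x : X, ∃ χ, Adm f X χ ∧ ∀ y : X, s (x, y) ≤ χ y - χ x) →
        ∫ z, s z ∂γ ≤ D := by
  have hXc : CompactSpace X := isCompact_iff_compactSpace.1 hX
  have hXn : Nonempty X := hXne.to_subtype
  have hemb : MeasurableEmbedding (Subtype.val : X → Ed d) :=
    MeasurableEmbedding.subtype_coe hX.measurableSet
  have hintg : ∀ (p : Measure X) [IsFiniteMeasure p] (g : C(X, ℝ)), Integrable (fun y => g y) p :=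
    fun p _ g => Integrable.of_bound g.continuous.aestronglyMeasurable ‖g‖
      (Eventually.of_forall g.norm_coe_le_norm)
  have hinte : ∀ (p : Measure X) [IsFiniteMeasure p] (φ : C(X, ℝ)),
      Integrable (fun y : X => env f X φ y) p := by
    intro p _ φ
    obtain ⟨C, hC⟩ := env_bound (f := f) hX φ
    exact Integrable.of_bound ((env_measurable hX φ).comp measurable_subtype_coe).aestronglyMeasurable
      C (Eventually.of_forall fun y => hC y)
  let K : C(X × X, ℝ) → ℝ → Prop := fun k r => ∃ a b : C(X, ℝ), ∃ t : ℝ, 0 ≤ t ∧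
    (∀ x : X, ∃ χ, Adm f X χ ∧ ∀ y : X, k (x, y) ≤ a x + b y + t * (χ y - χ x)) ∧
    r = ∫ y, a y ∂μ + ∫ y, b y ∂ν + t * D
  obtain ⟨L, hL⟩ := hb_aux K
    (by
      rintro k r k' r' ⟨a, b, t, ht, hk, rfl⟩ ⟨a', b', t', ht', hk', rfl⟩
      refine ⟨a + a', b + b', t + t', add_nonneg ht ht', fun x => ?_, ?_⟩
      · obtain ⟨χ, hχ, h1⟩ := hk x
        obtain ⟨χ', hχ', h1'⟩ := hk' x
        rcases (add_nonneg ht ht').eq_or_lt with h0 | h0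
        · have e1 : t = 0 := by linarith
          have e2 : t' = 0 := by linarith
          subst e1 e2
          refine ⟨χ, hχ, fun y => ?_⟩
          simp only [ContinuousMap.add_apply]
          linarith [h1 y, h1' y]
        · have hab : t / (t + t') + t' / (t + t') = 1 := by rw [← add_div, div_self h0.ne']
          refine ⟨_, hχ.comb hχ' (div_nonneg ht h0.le) (div_nonneg ht' h0.le) hab.le,
            fun y => ?_⟩
          have e : (t + t') * (t / (t + t') * χ y + t' / (t + t') * χ' y
              - (t / (t + t') * χ x + t' / (t + t') * χ' x))
              = t * (χ y - χ x) + t' * (χ' y - χ' x) := by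
            field_simp
            ring
          simp only [ContinuousMap.add_apply]
          rw [e]
          linarith [h1 y, h1' y]
      · simp only [ContinuousMap.add_apply]
        rw [integral_add (hintg μ a) (hintg μ a'), integral_add (hintg ν b) (hintg ν b')]
        ring)
    (by
      rintro c hc k r ⟨a, b, t, ht, hk, rfl⟩
      refine ⟨c • a, c • b, c * t, mul_nonneg hc.le ht, fun x => ?_, ?_⟩
      · obtain ⟨χ, hχ, h1⟩ := hk x
        refine ⟨χ, hχ, fun y => ?_⟩
        simp only [ContinuousMap.smul_apply, smul_eq_mul]
        have := mul_le_mul_of_nonneg_left (h1 y) hc.le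
        linarith
      · simp only [ContinuousMap.smul_apply, smul_eq_mul]
        rw [integral_const_mul, integral_const_mul]
        ring)
    (by
      intro k
      refine ⟨_, ContinuousMap.const X ‖k‖, 0, 0, le_rfl, fun x => ⟨_, Adm.zero f X, fun y => ?_⟩,
        rfl⟩
      have := (le_abs_self _).trans (k.norm_coe_le_norm (x, y))
      simpa using this)
    (by
      rintro r ⟨a, b, t, ht, hk, rfl⟩
      rcases ht.eq_or_lt with h0 | h0
      · subst h0
        obtain ⟨x0, -, hx0'⟩ := isCompact_univ.exists_isMinOn univ_nonempty
          a.continuous.continuousOn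
        have hx0 : ∀ y, a x0 ≤ a y := fun y => hx0' (mem_univ y)
        obtain ⟨χ, hχ, h1⟩ := hk x0
        have e1 : ∫ _ : X, a x0 ∂μ ≤ ∫ y, a y ∂μ :=
          integral_mono (integrable_const _) (hintg μ a) hx0
        have e2 : ∫ _ : X, -a x0 ∂ν ≤ ∫ y, b y ∂ν :=
          integral_mono (integrable_const _) (hintg ν b) fun y => by
            have := h1 y
            simp only [ContinuousMap.zero_apply] at this
            linarith
        rw [integral_const, smul_eq_mul, measureReal_def] at e1 e2
        rw [hmass] at e1
        linarith
      · set φ : C(X, ℝ) := (-t⁻¹) • b with hφ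
        have h1 : ∀ x : X, env f X φ x ≤ t⁻¹ * a x := by
          intro x
          obtain ⟨χ, hχ, h1⟩ := hk x
          obtain ⟨χ', hχ', h2⟩ := hχ.add_const hX.isBounded (t⁻¹ * a x - χ x)
          have h3 := env_le φ hχ' (fun y => by
            rw [h2 y y.2, hφ, ContinuousMap.smul_apply, smul_eq_mul]
            have := h1 y
            simp only [ContinuousMap.zero_apply] at this
            have h4 := mul_nonneg (inv_pos.2 h0).le this
            rw [mul_add, mul_add, ← mul_assoc, inv_mul_cancel₀ h0.ne'] at h4
            linarith) x.2
          rw [h2 x x.2] at h3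
          linarith
        have h2 : ∫ y : X, env f X φ y ∂μ ≤ t⁻¹ * ∫ y, a y ∂μ := by
          rw [← integral_const_mul]
          exact integral_mono (hinte μ φ) ((hintg μ a).const_mul _) h1
        have h3 : -t⁻¹ * ∫ y, b y ∂ν ≤ ∫ y : X, env f X φ y ∂ν := by
          rw [← integral_const_mul]
          exact integral_mono ((hintg ν b).const_mul _) (hinte ν φ) fun y => le_env hX φ y
        have h4 := h φ
        have h5 : -t⁻¹ * ∫ y, b y ∂ν - t⁻¹ * ∫ y, a y ∂μ ≤ D := by linarith
        have h6 := mul_le_mul_of_nonneg_left h5 h0.le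
        have e : t * (-t⁻¹ * ∫ y, b y ∂ν - t⁻¹ * ∫ y, a y ∂μ)
            = - ∫ y, b y ∂ν - ∫ y, a y ∂μ := by
          field_simp
        rw [e] at h6
        linarith)
  obtain ⟨γ, hγf, hγ⟩ := riesz_aux L (by
    intro g hg
    have := hL (-g) 0 ⟨0, 0, 0, le_rfl, fun x => ⟨_, Adm.zero f X, fun y => by
      have : 0 ≤ g (x, y) := hg (x, y)
      simp only [ContinuousMap.neg_apply, ContinuousMap.zero_apply]
      linarith⟩, by simp⟩
    rw [map_neg] at this
    linarith)
  have hfst : ∀ a : C(X, ℝ), L (a.comp ⟨Prod.fst, continuous_fst⟩) ≤ ∫ y, a y ∂μ := fun a =>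
    hL _ _ ⟨a, 0, 0, le_rfl, fun x => ⟨_, Adm.zero f X, fun y => by simp⟩, by simp⟩
  have hsnd : ∀ a : C(X, ℝ), L (a.comp ⟨Prod.snd, continuous_snd⟩) ≤ ∫ y, a y ∂ν := fun a =>
    hL _ _ ⟨0, a, 0, le_rfl, fun x => ⟨_, Adm.zero f X, fun y => by simp⟩, by simp⟩
  refine ⟨γ, hγf, ?_, ?_, fun s hs => ?_⟩
  · refine ext_of_forall_integral_eq_of_IsFiniteMeasure fun g => ?_
    rw [integral_map measurable_fst.aemeasurable g.continuous.aestronglyMeasurable]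
    have h1 := hγ (g.toContinuousMap.comp ⟨Prod.fst, continuous_fst⟩)
    have h2 := hfst g.toContinuousMap
    have h3 := hfst (-g.toContinuousMap)
    have e : (-g.toContinuousMap).comp ⟨Prod.fst, continuous_fst⟩ =
      -(g.toContinuousMap.comp ⟨Prod.fst, continuous_fst⟩ : C(X × X, ℝ)) := rfl
    rw [e, map_neg] at h3
    simp only [ContinuousMap.neg_apply] at h3
    rw [integral_neg] at h3
    exact Eq.trans h1 (le_antisymm h2 (neg_le_neg_iff.1 h3))
  · refine ext_of_forall_integral_eq_of_IsFiniteMeasure fun g => ?_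
    rw [integral_map measurable_snd.aemeasurable g.continuous.aestronglyMeasurable]
    have h1 := hγ (g.toContinuousMap.comp ⟨Prod.snd, continuous_snd⟩)
    have h2 := hsnd g.toContinuousMap
    have h3 := hsnd (-g.toContinuousMap)
    have e : (-g.toContinuousMap).comp ⟨Prod.snd, continuous_snd⟩ =
      -(g.toContinuousMap.comp ⟨Prod.snd, continuous_snd⟩ : C(X × X, ℝ)) := rfl
    rw [e, map_neg] at h3
    simp only [ContinuousMap.neg_apply] at h3
    rw [integral_neg] at h3
    exact Eq.trans h1 (le_antisymm h2 (neg_le_neg_iff.1 h3))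
  · rw [hγ]
    refine hL s D ⟨0, 0, 1, zero_le_one, fun x => ?_, by simp⟩
    obtain ⟨χ, h1, h2⟩ := hs x
    exact ⟨χ, h1, fun y => by simpa using h2 y⟩

end Plan

/-! ### From plans to kernels -/

section KernelPart

open ProbabilityTheory

variable {d : ℕ}

lemma continuous_integral_sub {Y : Type*} [MetricSpace Y] [CompactSpace Y] [MeasurableSpace Y]
    [BorelSpace Y] (p : Measure Y) [IsProbabilityMeasure p] (x : Y) :
    Continuous fun T : C(Y, ℝ) => ∫ y, T y ∂p - T x := by
  have hintg : ∀ g : C(Y, ℝ), Integrable (fun y => g y) p :=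
    fun g => Integrable.of_bound g.continuous.aestronglyMeasurable ‖g‖
      (Eventually.of_forall g.norm_coe_le_norm)
  refine Continuous.sub ?_ (continuous_eval_const x)
  refine (LipschitzWith.of_dist_le_mul (K := 1) fun S T => ?_).continuous
  rw [NNReal.coe_one, one_mul, dist_eq_norm, dist_eq_norm, ← integral_sub (hintg S) (hintg T)]
  have := norm_integral_le_of_norm_le_const (μ := p) (f := fun y => S y - T y) (C := ‖S - T‖)
    (Eventually.of_forall fun y => (S - T).norm_coe_le_norm y)
  simpa using this

lemma hcost_le {f : Matd d → ℝ≥0∞} (hA1 : CostA1 f) (hA2 : CostA2 f) {X : Set (Ed d)}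
    (hX : IsCompact X) (hXne : X.Nonempty)
    (μ ν : Measure X) [IsFiniteMeasure μ] [IsFiniteMeasure ν] (hmass : μ univ = ν univ)
    (D : ℝ) (h : ∀ φ : C(X, ℝ), ∫ y : X, env f X φ y ∂ν - ∫ y : X, env f X φ y ∂μ ≤ D) :
    Hcost f X (μ.map Subtype.val) (ν.map Subtype.val) ≤ ENNReal.ofReal D := by
  have hXc : CompactSpace X := isCompact_iff_compactSpace.1 hX
  have hXn : Nonempty X := hXne.to_subtype
  have hSB : StandardBorelSpace X := hX.measurableSet.standardBorel
  have hemb : MeasurableEmbedding (Subtype.val : X → Ed d) :=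
    MeasurableEmbedding.subtype_coe hX.measurableSet
  obtain ⟨γ, hγf, hγ1, hγ2, hγs⟩ := plan_exists hX hXne μ ν hmass D h
  set κ : Kernel X X := γ.condKernel with hκ
  have hdis : μ ⊗ₘ κ = γ := by
    have := γ.disintegrate γ.condKernel
    rwa [Measure.fst, hγ1] at this
  have hsc : SecondCountableTopology C(X, ℝ) := inferInstance
  obtain ⟨T, hT, hTs⟩ := exists_seq_sup {S : C(X, ℝ) | ∃ χ, Adm f X χ ∧ ∀ y : X, S y = χ y}
    ⟨0, _, Adm.zero f X, fun _ => rfl⟩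
  choose χ hχ hTχ using hT
  set g : ℕ → X → ℝ := fun k x => ∫ y, T k y ∂(κ x) - T k x with hg
  have hgm : ∀ k, Measurable (g k) := by
    intro k
    have h1 : StronglyMeasurable fun x => ∫ y, T k y ∂(κ x) :=
      StronglyMeasurable.integral_kernel (T k).continuous.stronglyMeasurable
    exact h1.measurable.sub (T k).continuous.measurable
  have hgi : ∀ k, Integrable (g k) μ := by
    intro k
    refine Integrable.of_bound (hgm k).aestronglyMeasurable (‖T k‖ + ‖T k‖)
      (Eventually.of_forall fun x => (norm_sub_le _ _).trans (add_le_add ?_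
        ((T k).norm_coe_le_norm x)))
    have := norm_integral_le_of_norm_le_const (μ := κ x) (f := fun y => T k y) (C := ‖T k‖)
      (Eventually.of_forall fun y => (T k).norm_coe_le_norm y)
    simpa using this
  have hcost : ∫⁻ x, ⨆ k, ENNReal.ofReal (g k x) ∂μ ≤ ENNReal.ofReal D := by
    refine part_aux μ g hgm hgi D fun n w hw0 hw1 => ?_
    let s : ℕ → C(X × X, ℝ) := fun k => ⟨fun z => w k z.1 * (T k z.2 - T k z.1), by fun_prop⟩
    have hsi : ∀ k, Integrable (s k) γ := fun k =>
      Integrable.of_bound (s k).continuous.aestronglyMeasurable ‖s k‖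
        (Eventually.of_forall (s k).norm_coe_le_norm)
    have h1 : ∫ z, (∑ k ∈ Finset.range n, s k) z ∂γ ≤ D := by
      refine hγs _ fun x => ⟨_, Adm.sum (Finset.range n) (fun k => w k x) χ
        (fun k _ => hw0 k x) (hw1 x) hχ, fun y => ?_⟩
      rw [ContinuousMap.sum_apply, ← Finset.sum_sub_distrib]
      refine Finset.sum_le_sum fun k _ => le_of_eq ?_
      simp only [s, ContinuousMap.coe_mk, hTχ]
      ring
    simp only [ContinuousMap.sum_apply] at h1
    rw [integral_finsetSum _ fun k _ => hsi k] at h1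
    refine le_trans (le_of_eq ?_) h1
    refine Finset.sum_congr rfl fun k _ => ?_
    have h2 : Integrable (s k) (μ ⊗ₘ κ) := by rw [hdis]; exact hsi k
    rw [← hdis, Measure.integral_compProd h2]
    refine integral_congr_ae (Eventually.of_forall fun x => ?_)
    have hTi : Integrable (fun y => T k y) (κ x) :=
      Integrable.of_bound (T k).continuous.aestronglyMeasurable ‖T k‖
        (Eventually.of_forall (T k).norm_coe_le_norm)
    simp only [s, ContinuousMap.coe_mk, hg]
    rw [integral_const_mul, integral_sub hTi (integrable_const _)]
    simp
  have hGle : ∀ x : X, Gcost f X x ((κ x).map Subtype.val) ≤ ⨆ k, ENNReal.ofReal (g k x) := by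
    intro x
    by_cases htop : ⨆ k, ENNReal.ofReal (g k x) = ⊤
    · rw [htop]; exact le_top
    rw [← ENNReal.ofReal_toReal htop]
    refine strong_duality hA1 hA2 hX _ _ _ ENNReal.toReal_nonneg fun χ' hχ' => ?_
    rw [integral_dirac, hemb.integral_map, ← ENNReal.ofReal_le_iff_le_toReal htop]
    let S : C(X, ℝ) := ⟨fun y => χ' y, hχ'.1.1.continuous.comp continuous_subtype_val⟩
    exact hTs _ (continuous_integral_sub (κ x) x) S ⟨χ', hχ', fun _ => rfl⟩
  obtain ⟨x0, hx0⟩ := hXne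
  let κ' : Ed d → Measure (Ed d) := fun x =>
    if hx : x ∈ X then (κ ⟨x, hx⟩).map Subtype.val else Measure.dirac x0
  have hκ' : ∀ x : X, κ' x = (κ x).map Subtype.val := fun x => by
    simp only [κ', dif_pos x.2]
  have hker : IsTransportKernel X (μ.map Subtype.val) (ν.map Subtype.val) κ' := by
    refine ⟨fun x => ?_, fun A hA => ?_, fun A hA => ?_⟩
    · by_cases hx : x ∈ X
      · rw [hκ' ⟨x, hx⟩]
        refine ⟨Measure.isProbabilityMeasure_map hemb.measurable.aemeasurable, ?_⟩
        rw [hemb.map_apply]; simp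
      · simp only [κ', dif_neg hx]
        refine ⟨inferInstance, ?_⟩
        rw [Measure.dirac_apply' _ hX.measurableSet.compl]
        simp [hx0]
    · refine measurable_of_restrict_of_restrict_compl hX.measurableSet ?_ ?_
      · have : X.domRestrict (fun x => κ' x A) = fun x : X => κ x (Subtype.val ⁻¹' A) := by
          ext x
          rw [Set.domRestrict_apply, hκ' x, hemb.map_apply]
        rw [this]
        exact κ.measurable_coe (hemb.measurable hA)
      · have : (Xᶜ : Set (Ed d)).domRestrict (fun x => κ' x A) =
            fun _ => Measure.dirac x0 A := by
          ext ⟨x, hx⟩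
          simp only [Set.domRestrict_apply, κ', dif_neg hx]
        rw [this]
        exact measurable_const
    · have hA' : MeasurableSet (Subtype.val ⁻¹' A : Set X) := hemb.measurable hA
      rw [hemb.lintegral_map, hemb.map_apply, ← hγ2, Measure.map_apply measurable_snd hA', ← hdis,
        Measure.compProd_apply (measurable_snd hA')]
      refine lintegral_congr fun x => ?_
      rw [hκ' x, hemb.map_apply]
      rfl
  refine (sInf_le ⟨κ', hker, rfl⟩ : Hcost f X _ _ ≤ _).trans ?_
  rw [hemb.lintegral_map]
  refine le_trans (lintegral_mono fun x => ?_) hcost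
  rw [hκ' x]
  exact hGle x

lemma fstat_le {f : Matd d → ℝ≥0∞} (hA1 : CostA1 f) (hA2 : CostA2 f) {X : Set (Ed d)}
    (hX : IsCompact X) (μ ν : Measure (Ed d)) [IsFiniteMeasure μ] [IsFiniteMeasure ν] :
    Fstat f X μ ν ≤ Hcost f X μ ν := by
  refine le_sInf ?_
  rintro c ⟨κ, ⟨hκ1, hκ2, hκ3⟩, rfl⟩
  by_cases htop : ∫⁻ x, Gcost f X x (κ x) ∂μ = ⊤
  · rw [htop]; exact le_top
  rw [← ENNReal.ofReal_toReal htop]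
  refine strong_duality hA1 hA2 hX μ ν _ ENNReal.toReal_nonneg fun χ hχ => ?_
  rw [← ENNReal.ofReal_le_iff_le_toReal htop]
  let K : Kernel (Ed d) (Ed d) := ⟨κ, Measure.measurable_of_measurable_coe κ hκ2⟩
  have hK : ∀ x, K x = κ x := fun _ => rfl
  have hKm : IsMarkovKernel K := ⟨fun x => (hκ1 x).1⟩
  have hν : ν = (μ ⊗ₘ K).map Prod.snd := by
    ext A hA
    rw [Measure.map_apply measurable_snd hA, Measure.compProd_apply (measurable_snd hA),
      ← hκ3 A hA]
    rfl
  have hχc : Continuous χ := hχ.1.1.continuous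
  obtain ⟨C, hC⟩ := hχ.1.2.exists_bound_of_continuous hχc
  have hi0 : Integrable (fun z : Ed d × Ed d => χ z.2) (μ ⊗ₘ K) :=
    Integrable.of_bound (hχc.comp continuous_snd).aestronglyMeasurable C
      (Eventually.of_forall fun z => hC z.2)
  have hχν : ∫ y, χ y ∂ν = ∫ x, ∫ y, χ y ∂(K x) ∂μ := by
    rw [hν, integral_map measurable_snd.aemeasurable hχc.aestronglyMeasurable,
      Measure.integral_compProd hi0]
  have hi2 : Integrable (fun x => ∫ y, χ y ∂(K x)) μ := by
    have hm : StronglyMeasurable fun x => ∫ y, χ y ∂(K x) :=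
      StronglyMeasurable.integral_kernel hχc.stronglyMeasurable
    refine Integrable.of_bound hm.aestronglyMeasurable C (Eventually.of_forall fun x => ?_)
    have := norm_integral_le_of_norm_le_const (μ := K x) (f := χ) (C := C)
      (Eventually.of_forall hC)
    simpa using this
  rw [hχν, ← integral_sub hi2 (hχ.1.integrable μ)]
  have hi3 : Integrable (fun x => ∫ y, χ y ∂(K x) - χ x) μ := hi2.sub (hχ.1.integrable μ)
  rw [integral_eq_lintegral_pos_part_sub_lintegral_neg_part hi3]
  refine (ENNReal.ofReal_le_ofReal (sub_le_self _ ENNReal.toReal_nonneg)).trans ?_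
  refine ENNReal.ofReal_toReal_le.trans (lintegral_mono fun x => ?_)
  have := weak_duality hχ (Measure.dirac x) (κ x)
  rwa [integral_dirac] at this

end KernelPart
/-- Theorem 4.3, the approximation assumption. If every bounded upper
semicontinuous `ψ` with `−ψ = (−ψ)^G` can be approximated, dominatedly and `(μ+ν)`-a.e., by
functions `ψ_n ∈ C²_c(ℝ^d)` with `−ψ_n = (−ψ_n)^G` on `Ω`, then `F(μ,ν) = H(μ,ν)`. -/
theorem stmt13 {d : ℕ} (hd : 0 < d) (f : Matd d → ℝ≥0∞) (hA1 : CostA1 f) (hA2 : CostA2 f)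
    (Ω X : Set (Ed d)) (hΩopen : IsOpen Ω) (hΩconv : Convex ℝ Ω)
    (hΩbdd : Bornology.IsBounded Ω) (hΩne : Ω.Nonempty) (hX : X = closure Ω)
    (μ ν : Measure (Ed d)) [IsFiniteMeasure μ] [IsFiniteMeasure ν]
    (hμX : μ Xᶜ = 0) (hνX : ν Xᶜ = 0) (hmass : μ X = ν X)
    (happrox : ∀ ψ : Ed d → ℝ, (∃ C : ℝ, ∀ x ∈ X, |ψ x| ≤ C) →
      UpperSemicontinuousOn ψ X → GEq f X (fun y => -ψ y) X →
      ∃ (ψn : ℕ → Ed d → ℝ) (Φ : Ed d → ℝ), Integrable Φ (μ + ν) ∧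
        (∀ n, IsC2c (ψn n)) ∧
        (∀ n, GEq f X (fun y => -(ψn n) y) Ω) ∧
        (∀ n, ∀ᵐ x ∂(μ + ν), |ψn n x| ≤ |Φ x|) ∧
        (∀ᵐ x ∂(μ + ν), Tendsto (fun n => ψn n x) atTop (𝓝 (ψ x)))) :
    Fstat f X μ ν = Hcost f X μ ν := by
  have hXc : IsCompact X := by rw [hX]; exact hΩbdd.isCompact_closure
  have hXne : X.Nonempty := by rw [hX]; exact hΩne.closure
  refine le_antisymm (fstat_le hA1 hA2 hXc μ ν) ?_
  by_cases htop : Fstat f X μ ν = ⊤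
  · rw [htop]; exact le_top
  have hemb : MeasurableEmbedding (Subtype.val : X → Ed d) :=
    MeasurableEmbedding.subtype_coe hXc.measurableSet
  have hmap : ∀ p : Measure (Ed d), p Xᶜ = 0 → (p.comap (Subtype.val : X → Ed d)).map
      Subtype.val = p := by
    intro p hp
    rw [hemb.map_comap, Subtype.range_coe]
    exact Measure.restrict_eq_self_of_ae_mem (by rwa [ae_iff])
  have huniv : ∀ p : Measure (Ed d), (p.comap (Subtype.val : X → Ed d)) univ = p X := by
    intro p
    rw [hemb.comap_apply, image_univ, Subtype.range_coe]
  have hfμ : IsFiniteMeasure (μ.comap (Subtype.val : X → Ed d)) :=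
    ⟨by rw [huniv]; exact measure_lt_top μ X⟩
  have hfν : IsFiniteMeasure (ν.comap (Subtype.val : X → Ed d)) :=
    ⟨by rw [huniv]; exact measure_lt_top ν X⟩
  have hmain := hcost_le hA1 hA2 hXc hXne (μ.comap (Subtype.val : X → Ed d))
    (ν.comap (Subtype.val : X → Ed d)) (by rw [huniv, huniv, hmass])
    (Fstat f X μ ν).toReal ?_
  · rwa [hmap μ hμX, hmap ν hνX, ENNReal.ofReal_toReal htop] at hmain
  intro φ
  rw [← hemb.integral_map (env f X φ), ← hemb.integral_map (env f X φ), hmap μ hμX, hmap ν hνX]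
  obtain ⟨C, hC⟩ := env_bound (f := f) hXc φ
  obtain ⟨ψn, Φ, hΦ, hψ, hG, hdom, hlim⟩ := happrox (env f X φ) ⟨C, fun x _ => hC x⟩
    (env_usc hXc φ) (env_GEq hXc φ)
  rw [integrable_add_measure] at hΦ
  rw [ae_add_measure_iff] at hlim
  have hdom1 : ∀ n, ∀ᵐ x ∂μ, ‖ψn n x‖ ≤ |Φ x| := fun n => (ae_add_measure_iff.1 (hdom n)).1
  have hdom2 : ∀ n, ∀ᵐ x ∂ν, ‖ψn n x‖ ≤ |Φ x| := fun n => (ae_add_measure_iff.1 (hdom n)).2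
  have t1 := tendsto_integral_of_dominated_convergence (fun x => |Φ x|)
    (fun n => (hψ n).1.continuous.aestronglyMeasurable) hΦ.1.abs hdom1 hlim.1
  have t2 := tendsto_integral_of_dominated_convergence (fun x => |Φ x|)
    (fun n => (hψ n).1.continuous.aestronglyMeasurable) hΦ.2.abs hdom2 hlim.2
  refine le_of_tendsto' (t2.sub t1) fun n => ?_
  rw [← ENNReal.ofReal_le_iff_le_toReal htop]
  exact weak_duality (adm_of_GEq hA1 hA2 hΩopen hX hXc (hψ n) (hG n)) μ ν
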